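/- For a memoryless point-to-point communication system with causal encoder (achievability direction of Theorem 2): if there exist finite sets 𝒰, 𝒱 and a joint pmf P_{SXYŜUV} that factors as P_S(s)·P_U(u)·P_{V|SU}(v|s,u)·P_{X|SU}(x|s,u)·P_{Y|X}(y|x)·P_{Ŝ|UVY}(ŝ|u,v,y) and satisfies I(U,V;S) ≤ I(U,V;Y), then the marginal P_{SXYŜ} is achievable with a causal encoder. -/

import Mathlib

open scoped BigOperators

noncomputable section

/-- `p` is a probability mass function on the finite type `α`. -/
def IsPMF {α : Type*} [Fintype α] (p : α → ℝ) : Prop :=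
  (∀ a, 0 ≤ p a) ∧ (∑ a, p a) = 1

/-- Probability of the event `E` under the pmf `P`. -/
def prob {Ω : Type*} [Fintype Ω] (P : Ω → ℝ) (E : Set Ω) : ℝ :=
  ∑ ω, E.indicator P ω

/-- Probability that the random variable `f` takes the value `a`, under `P`. -/
def margProb {Ω A : Type*} [Fintype Ω] (P : Ω → ℝ) (f : Ω → A) (a : A) : ℝ :=
  prob P {ω | f ω = a}

/-- Mutual information `I(f;g)` (base-2 logarithms) of random variables `f`, `g`
defined on a finite probability space with pmf `P`. -/
def mutInfo {Ω A B : Type*} [Fintype Ω] [Fintype A] [Fintype B]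
    (P : Ω → ℝ) (f : Ω → A) (g : Ω → B) : ℝ :=
  ∑ a : A, ∑ b : B,
    margProb P (fun ω => (f ω, g ω)) (a, b) *
      Real.logb 2 (margProb P (fun ω => (f ω, g ω)) (a, b) /
        (margProb P f a * margProb P g b))

/-- Conditional mutual information `I(f;g|h)` (base-2 logarithms). -/
def condMutInfo {Ω A B C : Type*} [Fintype Ω] [Fintype A] [Fintype B] [Fintype C]
    (P : Ω → ℝ) (f : Ω → A) (g : Ω → B) (h : Ω → C) : ℝ :=
  ∑ a : A, ∑ b : B, ∑ c : C,
    margProb P (fun ω => (f ω, g ω, h ω)) (a, b, c) *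
      Real.logb 2
        ((margProb P (fun ω => (f ω, g ω, h ω)) (a, b, c) * margProb P h c) /
          (margProb P (fun ω => (f ω, h ω)) (a, c) *
            margProb P (fun ω => (g ω, h ω)) (b, c)))

/-- Total variation distance between two pmfs: half the ℓ¹ distance. -/
def tvDist {α : Type*} [Fintype α] (P Q : α → ℝ) : ℝ :=
  (∑ a, |P a - Q a|) / 2

/-- Empirical distribution of the sequence `w`. -/
def empDist {n : ℕ} {α : Type*} (w : Fin n → α) (a : α) : ℝ :=
  (∑ i : Fin n, ({i | w i = a} : Set (Fin n)).indicator (fun _ => (1 : ℝ)) i) / n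

/-- Causality classes for the encoder. -/
inductive EncoderClass | noncausal | causal | strictlyCausal

/-- The encoder `f` respects the causality class `c`:
a noncausal encoder has `Xᵢ = fᵢ(Sⁿ)`, a causal encoder has `Xᵢ = fᵢ(Sⁱ)`
(it only depends on `S₁,…,Sᵢ`), and a strictly causal encoder has
`Xᵢ = fᵢ(Sⁱ⁻¹)` (it only depends on `S₁,…,Sᵢ₋₁`). -/
def EncOK {n : ℕ} {S X : Type*} : EncoderClass → (Fin n → (Fin n → S) → X) → Prop
  | .noncausal, _ => True
  | .causal, f => ∀ (i : Fin n) (s s' : Fin n → S),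
      (∀ j, j ≤ i → s j = s' j) → f i s = f i s'
  | .strictlyCausal, f => ∀ (i : Fin n) (s s' : Fin n → S),
      (∀ j, j < i → s j = s' j) → f i s = f i s'

/-- The joint pmf of `(Sⁿ, Yⁿ)` induced by the i.i.d. source `PS`, the memoryless
channel `PYX` and the (deterministic) encoder `f`. -/
def inducedP {S X Y : Type*} {n : ℕ}
    (PS : S → ℝ) (PYX : X → Y → ℝ) (f : Fin n → (Fin n → S) → X) :
    (Fin n → S) × (Fin n → Y) → ℝ :=
  fun sy => (∏ i, PS (sy.1 i)) * ∏ i, PYX (f i sy.1) (sy.2 i)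

/-- `P` (a pmf on `S × X × Y × Z`) is achievable for the source `PS` and channel `PYX`
with an encoder of causality class `c`: for every `ε > 0` there are a block length
`n` and a block-`n` code such that with probability at least `1 - ε` the empirical
distribution of `(Sⁿ, Xⁿ, Yⁿ, Ŝⁿ)` is within total variation `ε` of `P`. -/
def Achievable {S X Y Z : Type*} [Fintype S] [Fintype X] [Fintype Y] [Fintype Z]
    (PS : S → ℝ) (PYX : X → Y → ℝ) (c : EncoderClass)
    (P : S × X × Y × Z → ℝ) : Prop :=
  ∀ ε : ℝ, 0 < ε →
    ∃ n : ℕ, 0 < n ∧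
      ∃ (f : Fin n → (Fin n → S) → X) (g : Fin n → (Fin n → Y) → Z),
        EncOK c f ∧
        prob (inducedP PS PYX f)
          {sy | ε <
            tvDist (empDist (fun i => (sy.1 i, f i sy.1, sy.2 i, g i sy.2))) P} < ε

open Classical in
/-- The real-valued indicator of a proposition. -/
def ind (p : Prop) : ℝ := if p then 1 else 0

theorem ind_of_true {p : Prop} (h : p) : ind p = 1 := by simp [ind, h]

theorem ind_of_false {p : Prop} (h : ¬p) : ind p = 0 := by simp [ind, h]

theorem ind_nonneg (p : Prop) : 0 ≤ ind p := by unfold ind; split_ifs <;> norm_num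

theorem ind_le_one (p : Prop) : ind p ≤ 1 := by unfold ind; split_ifs <;> norm_num

theorem ind_mono {p q : Prop} (h : p → q) : ind p ≤ ind q := by
  by_cases hp : p
  · rw [ind_of_true hp, ind_of_true (h hp)]
  · rw [ind_of_false hp]; exact ind_nonneg q

theorem ind_or_le (p q : Prop) : ind (p ∨ q) ≤ ind p + ind q := by
  by_cases hp : p <;> by_cases hq : q <;> simp [ind, hp, hq]

theorem ind_exists_le {ι : Type*} [Fintype ι] (p : ι → Prop) :
    ind (∃ i, p i) ≤ ∑ i, ind (p i) := by
  by_cases h : ∃ i, p i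
  · obtain ⟨i, hi⟩ := h
    calc ind (∃ i, p i) ≤ ind (p i) := by rw [ind_of_true hi]; exact ind_le_one _
      _ ≤ ∑ i, ind (p i) :=
        Finset.single_le_sum (fun j _ => ind_nonneg (p j)) (Finset.mem_univ i)
  · rw [ind_of_false h]; exact Finset.sum_nonneg fun i _ => ind_nonneg _

theorem IsPMF.pi {ι α : Type*} [Fintype ι] [DecidableEq ι] [Fintype α] {k : ι → α → ℝ}
    (hk : ∀ i, IsPMF (k i)) : IsPMF (fun c : ι → α => ∏ i, k i (c i)) := by
  refine ⟨fun c => Finset.prod_nonneg fun i _ => (hk i).1 _, ?_⟩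
  rw [← Fintype.prod_sum]
  exact Finset.prod_eq_one fun i _ => (hk i).2

theorem IsPMF.nonempty {α : Type*} [Fintype α] {p : α → ℝ} (hp : IsPMF p) : Nonempty α := by
  by_contra h
  rw [not_nonempty_iff] at h
  have := hp.2
  simp at this

theorem IsPMF.exists_le {α : Type*} [Fintype α] {p : α → ℝ} (hp : IsPMF p) (F : α → ℝ) :
    ∃ a, F a ≤ ∑ b, p b * F b := by
  have := hp.nonempty
  obtain ⟨a, ha⟩ := Finite.exists_min F
  refine ⟨a, ?_⟩
  calc F a = ∑ b, p b * F a := by rw [← Finset.sum_mul, hp.2, one_mul]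
    _ ≤ _ := Finset.sum_le_sum fun b _ => mul_le_mul_of_nonneg_left (ha b) (hp.1 b)

/-- One-coordinate marginal of a product of pmfs. -/
theorem sum_pi_coord {ι α : Type*} [Fintype ι] [DecidableEq ι] [Fintype α] {k : ι → α → ℝ}
    (hk : ∀ i, ∑ a, k i a = 1) (j : ι) (F : α → ℝ) :
    ∑ c : ι → α, (∏ i, k i (c i)) * F (c j) = ∑ a, k j a * F a := by
  have h : ∀ c : ι → α, (∏ i, k i (c i)) * F (c j)
      = ∏ i, (k i (c i) * if i = j then F (c i) else 1) := by
    intro c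
    rw [Finset.prod_mul_distrib, Fintype.prod_eq_single (f := fun i => if i = j then F (c i) else 1)
      j (fun x hx => by simp [hx])]
    simp
  simp_rw [h]
  rw [← Fintype.prod_sum (f := fun i a => k i a * if i = j then F a else 1),
    Fintype.prod_eq_single j]
  · simp
  · intro x hx
    simp [hx, hk]

/-- Two-coordinate marginal of a product of pmfs, for a function of product form. -/
theorem sum_pi_coord_mul {ι α : Type*} [Fintype ι] [DecidableEq ι] [Fintype α] {k : ι → α → ℝ}
    (hk : ∀ i, ∑ a, k i a = 1) {j l : ι} (hjl : j ≠ l) (F G : α → ℝ) :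
    ∑ c : ι → α, (∏ i, k i (c i)) * (F (c j) * G (c l))
      = (∑ a, k j a * F a) * ∑ a, k l a * G a := by
  have h : ∀ c : ι → α, (∏ i, k i (c i)) * (F (c j) * G (c l))
      = ∏ i, (k i (c i) * if i = j then F (c i) else if i = l then G (c i) else 1) := by
    intro c
    rw [Finset.prod_mul_distrib, Fintype.prod_eq_mul
      (f := fun i => if i = j then F (c i) else if i = l then G (c i) else 1)
      j l hjl (fun x hx => by simp [hx])]
    simp [hjl.symm]
  simp_rw [h]
  rw [← Fintype.prod_sum
    (f := fun i a => k i a * if i = j then F a else if i = l then G a else 1),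
    Fintype.prod_eq_mul j l hjl]
  · simp [hjl.symm]
  · intro x hx
    simp [hx, hk]

/-- Variance of a sum of i.i.d. centered random variables. -/
theorem sum_pi_sq {ι α : Type*} [Fintype ι] [DecidableEq ι] [Fintype α] {p : α → ℝ}
    (hp : ∑ a, p a = 1) (ψ : α → ℝ) (hψ : ∑ a, p a * ψ a = 0) :
    ∑ c : ι → α, (∏ i, p (c i)) * (∑ i, ψ (c i)) ^ 2
      = Fintype.card ι * ∑ a, p a * ψ a ^ 2 := by
  simp_rw [sq, Finset.sum_mul_sum, Finset.mul_sum]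
  rw [Finset.sum_comm]
  have h : ∀ i : ι, ∑ c : ι → α, ∑ j, (∏ i, p (c i)) * (ψ (c i) * ψ (c j))
      = ∑ a, p a * (ψ a * ψ a) := by
    intro i
    rw [Finset.sum_comm, Fintype.sum_eq_single i]
    · exact sum_pi_coord (k := fun _ => p) (fun _ => hp) i (fun a => ψ a * ψ a)
    · intro j hj
      rw [sum_pi_coord_mul (k := fun _ => p) (fun _ => hp) hj.symm, hψ, zero_mul]
  simp_rw [h]
  simp [Finset.mul_sum]

/-- Weak law of large numbers (Chebyshev's inequality) for a product pmf. -/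
theorem chebyshev_pi {ι α : Type*} [Fintype ι] [DecidableEq ι] [Fintype α] {p : α → ℝ}
    (hp : IsPMF p) (φ : α → ℝ) {t : ℝ} (ht : 0 < t) :
    ∑ c : ι → α, (∏ i, p (c i)) * ind (t ≤ |∑ i, φ (c i) - Fintype.card ι * ∑ a, p a * φ a|)
      ≤ Fintype.card ι * (∑ a, p a * (φ a - ∑ b, p b * φ b) ^ 2) / t ^ 2 := by
  set μ := ∑ a, p a * φ a with hμ
  have h0 : ∑ a, p a * (φ a - μ) = 0 := by
    simp_rw [mul_sub]
    rw [Finset.sum_sub_distrib, ← Finset.sum_mul, hp.2, one_mul, ← hμ, sub_self]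
  rw [← sum_pi_sq (ι := ι) hp.2 (fun a => φ a - μ) h0, Finset.sum_div]
  refine Finset.sum_le_sum fun c _ => ?_
  rw [mul_div_assoc]
  refine mul_le_mul_of_nonneg_left ?_ (Finset.prod_nonneg fun i _ => hp.1 _)
  have he : ∑ i, (φ (c i) - μ) = ∑ i, φ (c i) - Fintype.card ι * μ := by
    simp [Finset.sum_sub_distrib]
  rw [he]
  by_cases hc : t ≤ |∑ i, φ (c i) - Fintype.card ι * μ|
  · rw [ind_of_true hc, one_le_div (by positivity), ← sq_abs (∑ i, φ (c i) - _)]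
    exact pow_le_pow_left₀ ht.le hc 2
  · rw [ind_of_false hc]; positivity

theorem eventually_prob_deviation_le {α : Type*} [Fintype α] {p : α → ℝ}
    (hp : IsPMF p) (φ : α → ℝ) {ε δ : ℝ} (hε : 0 < ε) (hδ : 0 < δ) :
    ∃ n₀ : ℕ, ∀ n ≥ n₀, ∑ c : Fin n → α, (∏ i, p (c i)) *
      ind (n * ε < |∑ i, φ (c i) - n * ∑ a, p a * φ a|) ≤ δ := by
  set σ := ∑ a, p a * (φ a - ∑ b, p b * φ b) ^ 2 with hσ
  have hσ0 : 0 ≤ σ := Finset.sum_nonneg fun a _ => mul_nonneg (hp.1 a) (sq_nonneg _)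
  obtain ⟨n₀, hn₀⟩ := exists_nat_gt (σ / (ε ^ 2 * δ))
  refine ⟨n₀ + 1, fun n hn => ?_⟩
  have hn1 : (n₀ : ℝ) + 1 ≤ n := by exact_mod_cast hn
  have hnpos : (0 : ℝ) < n := by
    have : (0 : ℝ) ≤ n₀ := Nat.cast_nonneg _
    linarith
  have key := chebyshev_pi (ι := Fin n) hp φ (t := n * ε) (by positivity)
  rw [Fintype.card_fin] at key
  calc _ ≤ _ := Finset.sum_le_sum fun c _ => mul_le_mul_of_nonneg_left
        (ind_mono le_of_lt) (Finset.prod_nonneg fun i _ => hp.1 _)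
    _ ≤ _ := key
    _ ≤ δ := by
      rw [← hσ, div_le_iff₀ (by positivity)]
      rw [div_lt_iff₀ (by positivity)] at hn₀
      have : σ ≤ n * (ε ^ 2 * δ) := by
        refine hn₀.le.trans (mul_le_mul_of_nonneg_right (by linarith) (by positivity))
      nlinarith

/-- The first absolute moment is at most the square root of the second moment. -/
theorem sum_mul_abs_le_sqrt {α : Type*} [Fintype α] {p : α → ℝ} (hp : IsPMF p) (φ : α → ℝ) :
    ∑ a, p a * |φ a| ≤ √(∑ a, p a * φ a ^ 2) := by
  refine Real.le_sqrt_of_sq_le ?_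
  set m := ∑ a, p a * |φ a| with hm
  have h : 0 ≤ ∑ a, p a * (|φ a| - m) ^ 2 :=
    Finset.sum_nonneg fun a _ => mul_nonneg (hp.1 a) (sq_nonneg _)
  have h2 : ∑ a, p a * (|φ a| - m) ^ 2 = ∑ a, p a * φ a ^ 2 - 2 * m * m + m ^ 2 := by
    have : ∀ a, p a * (|φ a| - m) ^ 2 = p a * φ a ^ 2 - 2 * m * (p a * |φ a|) + p a * m ^ 2 := by
      intro a; rw [← sq_abs (φ a)]; ring
    simp_rw [this]
    rw [Finset.sum_add_distrib, Finset.sum_sub_distrib, ← Finset.mul_sum, ← Finset.sum_mul, hp.2,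
      ← hm, one_mul]
  nlinarith

/-- The output law of the kernel `k` with input law `p`. -/
def mixW {S V : Type*} [Fintype S] (p : S → ℝ) (k : S → V → ℝ) (v : V) : ℝ := ∑ s, p s * k s v

/-- The posterior of the input of the kernel `k` with input law `p`. -/
def bayes {S V : Type*} [Fintype S] (p : S → ℝ) (k : S → V → ℝ) (v : V) (s : S) : ℝ :=
  p s * k s v / mixW p k v

theorem isPMF_mixW {S V : Type*} [Fintype S] [Fintype V] {p : S → ℝ} {k : S → V → ℝ}
    (hp : IsPMF p) (hk : ∀ s, IsPMF (k s)) : IsPMF (mixW p k) := by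
  refine ⟨fun v => Finset.sum_nonneg fun s _ => mul_nonneg (hp.1 s) ((hk s).1 v), ?_⟩
  unfold mixW
  rw [Finset.sum_comm]
  simp_rw [← Finset.mul_sum, (hk _).2, mul_one, hp.2]

theorem bayes_nonneg {S V : Type*} [Fintype S] [Fintype V] {p : S → ℝ} {k : S → V → ℝ}
    (hp : IsPMF p) (hk : ∀ s, IsPMF (k s)) (v : V) (s : S) : 0 ≤ bayes p k v s :=
  div_nonneg (mul_nonneg (hp.1 s) ((hk s).1 v)) ((isPMF_mixW hp hk).1 v)

theorem mixW_mul_bayes {S V : Type*} [Fintype S] [Fintype V] {p : S → ℝ} {k : S → V → ℝ}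
    (hp : IsPMF p) (hk : ∀ s, IsPMF (k s)) (v : V) (s : S) :
    mixW p k v * bayes p k v s = p s * k s v := by
  unfold bayes
  by_cases h : mixW p k v = 0
  · have := (Finset.sum_eq_zero_iff_of_nonneg
      (fun s _ => mul_nonneg (hp.1 s) ((hk s).1 v))).1 h s (Finset.mem_univ s)
    rw [this, h]; simp
  · field_simp

theorem sum_mixW_mul_bayes {S V : Type*} [Fintype S] [Fintype V] {p : S → ℝ} {k : S → V → ℝ}
    (hp : IsPMF p) (hk : ∀ s, IsPMF (k s)) (R : S → V → ℝ) :
    ∑ v, mixW p k v * ∑ s, bayes p k v s * R s v = ∑ s, p s * ∑ v, k s v * R s v := by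
  simp_rw [Finset.mul_sum, ← mul_assoc, mixW_mul_bayes hp hk]
  rw [Finset.sum_comm]

/-- Soft covering for one value of the source: the average of the posteriors over an i.i.d.
codebook of size `K` rarely falls short of the source probability. -/
theorem soft_covering_point {S V : Type*} [Fintype S] [Fintype V] {p : S → ℝ} {k : S → V → ℝ}
    (hp : IsPMF p) (hk : ∀ s, IsPMF (k s)) {K : ℕ} (hK : 0 < K) {Γ : ℝ} (hΓ : 0 ≤ Γ) (s : S) :
    ∑ v : Fin K → V, (∏ j, mixW p k (v j)) * max 0 (p s - ∑ j, bayes p k (v j) s / K)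
      ≤ ∑ v, p s * k s v * ind (Γ * mixW p k v < k s v) + p s * √(Γ / K) := by
  have hq := isPMF_mixW hp hk
  have hK' : (0 : ℝ) < K := by exact_mod_cast hK
  set q := mixW p k with hqdef
  set W : V → ℝ := fun v => bayes p k v s * ind (k s v ≤ Γ * q v) with hW
  set a := ∑ v, q v * W v with ha
  set b := ∑ v, p s * k s v * ind (Γ * q v < k s v) with hb
  have hW0 : ∀ v, 0 ≤ W v := fun v => mul_nonneg (bayes_nonneg hp hk v s) (ind_nonneg _)
  have hWle : ∀ v, W v ≤ bayes p k v s := fun v =>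
    mul_le_of_le_one_right (bayes_nonneg hp hk v s) (ind_le_one _)
  have hb0 : 0 ≤ b := Finset.sum_nonneg fun v _ =>
    mul_nonneg (mul_nonneg (hp.1 s) ((hk s).1 v)) (ind_nonneg _)
  have hab : p s = a + b := by
    rw [ha, hb, ← Finset.sum_add_distrib]
    have : ∀ v, q v * W v + p s * k s v * ind (Γ * q v < k s v) = p s * k s v := by
      intro v
      rw [hW]
      simp only
      rw [← mul_assoc, hqdef, mixW_mul_bayes hp hk, ← mul_add]
      by_cases h : Γ * mixW p k v < k s v
      · rw [ind_of_true h, ind_of_false (not_le.2 h)]; ring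
      · rw [ind_of_false h, ind_of_true (not_lt.1 h)]; ring
    simp_rw [this]
    rw [← Finset.mul_sum, (hk s).2, mul_one]
  have hWΓ : ∀ v, W v ≤ Γ * p s := by
    intro v
    by_cases h : k s v ≤ Γ * q v
    · simp only [hW, ind_of_true h, mul_one]
      unfold bayes
      rcases (hq.1 v).eq_or_lt with h0 | h0
      · rw [← hqdef, ← h0, div_zero]; exact mul_nonneg hΓ (hp.1 s)
      · rw [← hqdef, div_le_iff₀ h0]
        nlinarith [mul_le_mul_of_nonneg_left h (hp.1 s)]
    · simp only [hW, ind_of_false h, mul_zero]; exact mul_nonneg hΓ (hp.1 s)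
  have hcent : ∑ v, q v * (W v - a) = 0 := by
    simp_rw [mul_sub]
    rw [Finset.sum_sub_distrib, ← Finset.sum_mul, hq.2, ← ha]; ring
  have hpi : IsPMF (fun c : Fin K → V => ∏ j, q (c j)) := IsPMF.pi (fun _ => hq)
  have hvar : ∑ c : Fin K → V, (∏ j, q (c j)) * ((∑ j, (W (c j) - a)) / K) ^ 2
      ≤ Γ / K * p s ^ 2 := by
    have h1 := sum_pi_sq (ι := Fin K) hq.2 (fun v => W v - a) hcent
    rw [Fintype.card_fin] at h1
    simp_rw [div_pow, ← mul_div_assoc]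
    rw [← Finset.sum_div, h1, div_le_iff₀ (by positivity)]
    have h2 : ∑ v, q v * (W v - a) ^ 2 ≤ Γ * p s * p s := by
      calc ∑ v, q v * (W v - a) ^ 2 = ∑ v, q v * W v ^ 2 - a ^ 2 := by
            have : ∀ v, q v * (W v - a) ^ 2 = q v * W v ^ 2 - 2 * a * (q v * W v) + q v * a ^ 2 :=
              fun v => by ring
            simp_rw [this]
            rw [Finset.sum_add_distrib, Finset.sum_sub_distrib, ← Finset.mul_sum, ← Finset.sum_mul,
              hq.2, ← ha]
            ring
        _ ≤ ∑ v, q v * W v ^ 2 := sub_le_self _ (sq_nonneg a)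
        _ ≤ ∑ v, Γ * p s * (q v * W v) := Finset.sum_le_sum fun v _ => by
            have := mul_le_mul_of_nonneg_left (hWΓ v) (mul_nonneg (hq.1 v) (hW0 v))
            nlinarith
        _ = Γ * p s * a := by rw [← Finset.mul_sum]
        _ ≤ Γ * p s * p s :=
            mul_le_mul_of_nonneg_left (by linarith) (mul_nonneg hΓ (hp.1 s))
    calc (K : ℝ) * ∑ v, q v * (W v - a) ^ 2 ≤ K * (Γ * p s * p s) :=
          mul_le_mul_of_nonneg_left h2 hK'.le
      _ = _ := by field_simp
  have habs := sum_mul_abs_le_sqrt hpi (fun c => (∑ j, (W (c j) - a)) / K)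
  have hsqrt : √(∑ c : Fin K → V, (∏ j, q (c j)) * ((∑ j, (W (c j) - a)) / K) ^ 2)
      ≤ p s * √(Γ / K) := by
    calc _ ≤ √(Γ / K * p s ^ 2) := Real.sqrt_le_sqrt hvar
      _ = _ := by rw [Real.sqrt_mul' _ (sq_nonneg _), Real.sqrt_sq (hp.1 s), mul_comm]
  calc ∑ v : Fin K → V, (∏ j, q (v j)) * max 0 (p s - ∑ j, bayes p k (v j) s / K)
      ≤ ∑ v : Fin K → V, ((∏ j, q (v j)) * b
          + (∏ j, q (v j)) * |(∑ j, (W (v j) - a)) / K|) := by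
        refine Finset.sum_le_sum fun v _ => ?_
        rw [← mul_add]
        refine mul_le_mul_of_nonneg_left (max_le (by positivity) ?_) (hpi.1 v)
        have h1 : (∑ j, (W (v j) - a)) / K = (∑ j, W (v j)) / K - a := by
          rw [Finset.sum_sub_distrib]
          simp
          field_simp
        have h2 : (∑ j, W (v j)) / K ≤ ∑ j, bayes p k (v j) s / K := by
          rw [← Finset.sum_div]
          exact div_le_div_of_nonneg_right (Finset.sum_le_sum fun j _ => hWle _) hK'.le
        have h3 := neg_abs_le ((∑ j, (W (v j) - a)) / K)
        rw [h1] at h3 ⊢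
        linarith
    _ = b + ∑ v : Fin K → V, (∏ j, q (v j)) * |(∑ j, (W (v j) - a)) / K| := by
        rw [Finset.sum_add_distrib, ← Finset.sum_mul, hpi.2, one_mul]
    _ ≤ _ := by linarith

/-- Soft covering. -/
theorem soft_covering {S V : Type*} [Fintype S] [Fintype V] {p : S → ℝ} {k : S → V → ℝ}
    (hp : IsPMF p) (hk : ∀ s, IsPMF (k s)) {K : ℕ} (hK : 0 < K) {Γ : ℝ} (hΓ : 0 ≤ Γ) :
    ∑ v : Fin K → V, (∏ j, mixW p k (v j)) * ∑ s, max 0 (p s - ∑ j, bayes p k (v j) s / K)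
      ≤ ∑ s, p s * ∑ v, k s v * ind (Γ * mixW p k v < k s v) + √(Γ / K) := by
  simp_rw [Finset.mul_sum]
  rw [Finset.sum_comm]
  calc _ ≤ ∑ s, (∑ v, p s * k s v * ind (Γ * mixW p k v < k s v) + p s * √(Γ / K)) :=
        Finset.sum_le_sum fun s _ => soft_covering_point hp hk hK hΓ s
    _ = _ := by
        rw [Finset.sum_add_distrib, ← Finset.sum_mul, hp.2, one_mul]
        simp_rw [mul_assoc]

/-- If the auxiliary variable is independent of the source, one codeword covers perfectly. -/
theorem soft_covering_of_const {S V : Type*} [Fintype S] [Fintype V] {p : S → ℝ} {r : V → ℝ}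
    (hp : IsPMF p) :
    ∑ v : Fin 1 → V, (∏ j, mixW p (fun _ => r) (v j)) *
      ∑ s, max 0 (p s - ∑ j, bayes p (fun _ => r) (v j) s / (1 : ℕ)) = 0 := by
  refine Finset.sum_eq_zero fun v _ => ?_
  have hm : ∀ w, mixW p (fun _ => r) w = r w := fun w => by
    unfold mixW; rw [← Finset.sum_mul, hp.2, one_mul]
  simp only [bayes, hm, Fin.prod_univ_one, Fin.sum_univ_one]
  by_cases h : r (v 0) = 0
  · simp [h]
  · have : ∀ s, p s - p s * r (v 0) / r (v 0) / (1 : ℕ) = 0 := fun s => by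
      field_simp; simp
    exact mul_eq_zero_of_right _ (Finset.sum_eq_zero fun s _ => by rw [this s, max_self])

theorem exists_mul_le_sum_add {ι : Type*} [Fintype ι] [Nonempty ι] (w ℓ : ι → ℝ) (p : ℝ)
    (hw : ∀ j, 0 ≤ w j) (h0 : ∀ j, 0 ≤ ℓ j) (h1 : ∀ j, ℓ j ≤ 1) :
    ∃ j, p * ℓ j ≤ ∑ i, w i * ℓ i + max 0 (p - ∑ i, w i) := by
  obtain ⟨j, hj⟩ := Finite.exists_min ℓ
  refine ⟨j, ?_⟩
  have h2 : (∑ i, w i) * ℓ j ≤ ∑ i, w i * ℓ i := by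
    rw [Finset.sum_mul]
    exact Finset.sum_le_sum fun i _ => mul_le_mul_of_nonneg_left (hj i) (hw i)
  have h3 : (p - ∑ i, w i) * ℓ j ≤ max 0 (p - ∑ i, w i) :=
    (mul_le_mul_of_nonneg_right (le_max_right 0 _) (h0 j)).trans
      (mul_le_of_le_one_right (le_max_left _ _) (h1 j))
  nlinarith

/-- Derandomization of the message selection at the encoder and of the reconstruction at the
decoder, for an arbitrary loss `E`. -/
theorem exists_encoder_decoder {M K S Y Z : Type*} [Fintype M] [Fintype K] [Fintype S]
    [Fintype Y] [Fintype Z] [Nonempty K]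
    {q : M → ℝ} {p : S → ℝ} {H : M → S → Y → ℝ} {κ : Y → K → Z → ℝ}
    (hq : IsPMF q) (hH : ∀ m s, IsPMF (H m s)) (hκ : ∀ y j, IsPMF (κ y j))
    {w : M → S → K → ℝ} (hw : ∀ m s j, 0 ≤ w m s j)
    {E : M → S → Y → K → Z → ℝ} (hE0 : ∀ m s y j z, 0 ≤ E m s y j z)
    (hE1 : ∀ m s y j z, E m s y j z ≤ 1) :
    ∃ (F : M → S → K) (g : Y → K → Z),
      ∑ m, q m * ∑ s, p s * ∑ y, H m s y * E m s y (F m s) (g y (F m s))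
        ≤ ∑ m, q m * ∑ s, (∑ j, w m s j * (∑ y, H m s y * ∑ z, κ y j z * E m s y j z)
            + max 0 (p s - ∑ j, w m s j)) := by
  classical
  have hin1 : ∀ m s y j, ∑ z, κ y j z * E m s y j z ≤ 1 := fun m s y j =>
    calc ∑ z, κ y j z * E m s y j z ≤ ∑ z, κ y j z :=
          Finset.sum_le_sum fun z _ => mul_le_of_le_one_right ((hκ y j).1 z) (hE1 _ _ _ _ _)
      _ = 1 := (hκ y j).2
  have hin0 : ∀ m s y j, 0 ≤ ∑ z, κ y j z * E m s y j z := fun m s y j =>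
    Finset.sum_nonneg fun z _ => mul_nonneg ((hκ y j).1 z) (hE0 _ _ _ _ _)
  have hF : ∀ m s, ∃ j, p s * (∑ y, H m s y * ∑ z, κ y j z * E m s y j z)
      ≤ ∑ i, w m s i * (∑ y, H m s y * ∑ z, κ y i z * E m s y i z)
        + max 0 (p s - ∑ i, w m s i) := by
    intro m s
    refine exists_mul_le_sum_add (w m s) (fun j => ∑ y, H m s y * ∑ z, κ y j z * E m s y j z)
      (p s) (hw m s) (fun j => ?_) (fun j => ?_)
    · exact Finset.sum_nonneg fun y _ => mul_nonneg ((hH m s).1 y) (hin0 m s y j)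
    · calc _ ≤ ∑ y, H m s y := Finset.sum_le_sum fun y _ =>
            mul_le_of_le_one_right ((hH m s).1 y) (hin1 m s y j)
        _ = 1 := (hH m s).2
  choose F hF using hF
  have hg : ∀ y j, ∃ z, ∑ m, ∑ s, q m * p s * H m s y * ind (F m s = j) * E m s y j z
      ≤ ∑ z', κ y j z' * ∑ m, ∑ s, q m * p s * H m s y * ind (F m s = j) * E m s y j z' :=
    fun y j => (hκ y j).exists_le
      (fun z => ∑ m, ∑ s, q m * p s * H m s y * ind (F m s = j) * E m s y j z)
  choose g hg using hg
  refine ⟨F, g, ?_⟩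
  have hsel : ∀ (m : M) (s : S) (G : K → ℝ), ∑ j, ind (F m s = j) * G j = G (F m s) := by
    intro m s G
    simp [ind]
  calc ∑ m, q m * ∑ s, p s * ∑ y, H m s y * E m s y (F m s) (g y (F m s))
      = ∑ m, ∑ s, ∑ y, ∑ j, q m * p s * H m s y * ind (F m s = j) * E m s y j (g y j) := by
        refine Finset.sum_congr rfl fun m _ => ?_
        rw [Finset.mul_sum]
        refine Finset.sum_congr rfl fun s _ => ?_
        rw [Finset.mul_sum, Finset.mul_sum]
        refine Finset.sum_congr rfl fun y _ => ?_
        rw [← hsel m s (fun j => E m s y j (g y j)), Finset.mul_sum, Finset.mul_sum,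
          Finset.mul_sum]
        exact Finset.sum_congr rfl fun j _ => by ring
    _ = ∑ y, ∑ j, ∑ m, ∑ s, q m * p s * H m s y * ind (F m s = j) * E m s y j (g y j) := by
        simp_rw [Finset.sum_comm (s := (Finset.univ : Finset S)) (t := (Finset.univ : Finset Y))]
        rw [Finset.sum_comm]
        simp_rw [Finset.sum_comm (s := (Finset.univ : Finset S)) (t := (Finset.univ : Finset K))]
        simp_rw [Finset.sum_comm (s := (Finset.univ : Finset M)) (t := (Finset.univ : Finset K))]
    _ ≤ ∑ y, ∑ j, ∑ z, κ y j z *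
          ∑ m, ∑ s, q m * p s * H m s y * ind (F m s = j) * E m s y j z :=
        Finset.sum_le_sum fun y _ => Finset.sum_le_sum fun j _ => hg y j
    _ = ∑ m, ∑ s, ∑ y, ∑ j, ∑ z, κ y j z *
          (q m * p s * H m s y * ind (F m s = j) * E m s y j z) := by
        simp_rw [Finset.mul_sum]
        simp_rw [Finset.sum_comm (s := (Finset.univ : Finset Z)) (t := (Finset.univ : Finset M))]
        simp_rw [Finset.sum_comm (s := (Finset.univ : Finset K)) (t := (Finset.univ : Finset M))]
        rw [Finset.sum_comm]
        simp_rw [Finset.sum_comm (s := (Finset.univ : Finset Z)) (t := (Finset.univ : Finset S))]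
        simp_rw [Finset.sum_comm (s := (Finset.univ : Finset K)) (t := (Finset.univ : Finset S))]
        simp_rw [Finset.sum_comm (s := (Finset.univ : Finset Y)) (t := (Finset.univ : Finset S))]
    _ = ∑ m, q m * ∑ s, p s * ∑ y, H m s y * ∑ z, κ y (F m s) z * E m s y (F m s) z := by
        refine Finset.sum_congr rfl fun m _ => ?_
        rw [Finset.mul_sum]
        refine Finset.sum_congr rfl fun s _ => ?_
        rw [Finset.mul_sum, Finset.mul_sum]
        refine Finset.sum_congr rfl fun y _ => ?_
        rw [← hsel m s (fun j => ∑ z, κ y j z * E m s y j z), Finset.mul_sum, Finset.mul_sum,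
          Finset.mul_sum]
        refine Finset.sum_congr rfl fun j _ => ?_
        simp_rw [Finset.mul_sum]
        exact Finset.sum_congr rfl fun z _ => by ring
    _ ≤ _ := Finset.sum_le_sum fun m _ => mul_le_mul_of_nonneg_left
        (Finset.sum_le_sum fun s _ => hF m s) (hq.1 m)

/-- Marginal of the law of one row of the random codebook. -/
theorem sum_row_law {U V : Type*} [Fintype U] [Fintype V] {K : ℕ} {pU : U → ℝ} {r : U → V → ℝ}
    (hr : ∀ u, IsPMF (r u)) (j : Fin K) (φ : U → V → ℝ) :
    ∑ c : U × (Fin K → V), (pU c.1 * ∏ i, r c.1 (c.2 i)) * φ c.1 (c.2 j)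
      = ∑ u, pU u * ∑ v, r u v * φ u v := by
  rw [Fintype.sum_prod_type]
  refine Finset.sum_congr rfl fun u _ => ?_
  simp_rw [mul_assoc]
  rw [← Finset.mul_sum]
  rw [sum_pi_coord (k := fun _ => r u) (fun _ => (hr u).2) j (φ u)]

theorem sum_mul_sum_affine {Θ M S J : Type*} [Fintype Θ] [Fintype M] [Fintype S] [Fintype J]
    {τ : Θ → ℝ} (hτ : ∑ θ, τ θ = 1) (q : M → ℝ) (b : M → S → J → ℝ) (G : Θ → M → S → J → ℝ)
    (d : M → ℝ) :
    ∑ θ, τ θ * ∑ m, q m * (∑ s, ∑ j, b m s j * G θ m s j + d m)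
      = ∑ m, q m * (∑ s, ∑ j, b m s j * ∑ θ, τ θ * G θ m s j + d m) := by
  simp_rw [Finset.mul_sum (s := (Finset.univ : Finset M))]
  rw [Finset.sum_comm]
  refine Finset.sum_congr rfl fun m _ => ?_
  simp_rw [mul_left_comm (τ _) (q m)]
  rw [← Finset.mul_sum]
  simp_rw [mul_add]
  rw [Finset.sum_add_distrib, ← Finset.sum_mul, hτ, one_mul]
  rw [← mul_add]
  congr 2
  simp_rw [Finset.mul_sum (s := (Finset.univ : Finset S))]
  rw [Finset.sum_comm]
  refine Finset.sum_congr rfl fun s _ => ?_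
  simp_rw [Finset.mul_sum]
  rw [Finset.sum_comm]
  exact Finset.sum_congr rfl fun j _ => Finset.sum_congr rfl fun θ _ => by ring

theorem sum_mul_sum_affine_le {C M J : Type*} [Fintype C] [Fintype M] [Fintype J]
    {w : C → ℝ} {q : M → ℝ} {r : J → ℝ} {a b : C → M → J → ℝ} {d : C → M → ℝ} {α β γ : ℝ}
    (hq : IsPMF q) (hr : IsPMF r) (ha : ∀ m j, ∑ c, w c * a c m j ≤ α)
    (hb : ∀ m j, ∑ c, w c * b c m j ≤ β) (hd : ∀ m, ∑ c, w c * d c m ≤ γ) :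
    ∑ c, w c * ∑ m, q m * (∑ j, r j * (a c m j + b c m j) + d c m) ≤ α + β + γ := by
  have h1 : ∑ c, w c * ∑ m, q m * (∑ j, r j * (a c m j + b c m j) + d c m)
      = ∑ m, q m * (∑ j, r j * (∑ c, w c * a c m j + ∑ c, w c * b c m j)
        + ∑ c, w c * d c m) := by
    simp_rw [Finset.mul_sum (s := (Finset.univ : Finset M))]
    rw [Finset.sum_comm]
    refine Finset.sum_congr rfl fun m _ => ?_
    simp_rw [mul_left_comm (w _) (q m)]
    rw [← Finset.mul_sum]
    simp_rw [mul_add]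
    rw [Finset.sum_add_distrib, mul_add]
    congr 2
    simp_rw [Finset.mul_sum]
    rw [Finset.sum_comm]
    refine Finset.sum_congr rfl fun j _ => ?_
    rw [← Finset.sum_add_distrib]
    exact Finset.sum_congr rfl fun c _ => by ring
  rw [h1]
  calc _ ≤ ∑ m, q m * (∑ j, r j * (α + β) + γ) :=
        Finset.sum_le_sum fun m _ => mul_le_mul_of_nonneg_left
          (add_le_add (Finset.sum_le_sum fun j _ => mul_le_mul_of_nonneg_left
            (add_le_add (ha m j) (hb m j)) (hr.1 j)) (hd m)) (hq.1 m)
    _ = _ := by rw [← Finset.sum_mul, ← Finset.sum_mul, hr.2, hq.2]; ring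

theorem exists_one_shot_code {M S U V X Y Z Θ : Type*} [Fintype M] [Fintype S] [Fintype U]
    [Fintype V] [Fintype X] [Fintype Y] [Fintype Z] [Fintype Θ] {K : ℕ} (hK : 0 < K)
    {pS : S → ℝ} {pU : U → ℝ} {kV : S → U → V → ℝ} {kX : S → U → X → ℝ} {kY : X → Y → ℝ}
    {kZ : U → V → Y → Z → ℝ} {τ : Θ → ℝ} {app : Θ → S → U → X}
    (hpS : IsPMF pS) (hpU : IsPMF pU) (hkV : ∀ s u, IsPMF (kV s u))
    (hkY : ∀ x, IsPMF (kY x)) (hkZ : ∀ u v y, IsPMF (kZ u v y))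
    (hτ : IsPMF τ)
    (happ : ∀ s u (F : X → ℝ), ∑ θ, τ θ * F (app θ s u) = ∑ x, kX s u x * F x)
    (T : U → V → Y → Prop) (Bad : S → X → Y → Z → Prop) {α₁ α₂ α₃ β : ℝ}
    (hcov : ∑ u, pU u * ∑ v : Fin K → V, (∏ j, mixW pS (fun s => kV s u) (v j)) *
      ∑ s, max 0 (pS s - ∑ j, bayes pS (fun s => kV s u) (v j) s / K) ≤ α₁)
    (hT : ∑ u, pU u * ∑ s, pS s * ∑ v, kV s u v * ∑ x, kX s u x * ∑ y, kY x y *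
      ind (¬T u v y) ≤ α₂)
    (hβ : ∑ y, (∑ u, pU u * ∑ s, pS s * ∑ v, kV s u v * ∑ x, kX s u x * kY x y) *
      (∑ u, pU u * ∑ v, mixW pS (fun s => kV s u) v * ind (T u v y)) ≤ β)
    (hB : ∑ u, pU u * ∑ s, pS s * ∑ v, kV s u v * ∑ x, kX s u x * ∑ y, kY x y *
      ∑ z, kZ u v y z * ind (Bad s x y z) ≤ α₃)
    {q : M → ℝ} (hq : IsPMF q) :
    ∃ (u : M → U) (θ : Θ) (F : M → S → Fin K) (dec : Y → Fin K → M) (g : Y → Fin K → Z),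
      ∑ m, q m * ∑ s, pS s * ∑ y, kY (app θ s (u m)) y *
        ind (dec y (F m s) ≠ m ∨ Bad s (app θ s (u m)) y (g y (F m s)))
      ≤ α₁ + α₂ + (Fintype.card M - 1) * β + α₃ := by
  classical
  have : Nonempty (Fin K) := ⟨⟨0, hK⟩⟩
  have hK' : (0 : ℝ) < K := by exact_mod_cast hK
  obtain ⟨m₀⟩ := hq.nonempty
  set r : U → V → ℝ := fun u => mixW pS (fun s => kV s u) with hr
  set B : U → V → S → ℝ := fun u => bayes pS (fun s => kV s u) with hBdef
  have hr' : ∀ u, IsPMF (r u) := fun u => isPMF_mixW hpS (fun s => hkV s u)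
  have hB0 : ∀ u v s, 0 ≤ B u v s := fun u => bayes_nonneg hpS (fun s => hkV s u)
  set ν : U × (Fin K → V) → ℝ := fun c => pU c.1 * ∏ i, r c.1 (c.2 i) with hν
  have hνpmf : IsPMF ν := by
    refine ⟨fun c => mul_nonneg (hpU.1 _) (Finset.prod_nonneg fun i _ => (hr' _).1 _), ?_⟩
    rw [Fintype.sum_prod_type]
    simp only [hν]
    simp_rw [← Finset.mul_sum, (IsPMF.pi (ι := Fin K) (fun _ => hr' _)).2, mul_one, hpU.2]
  -- the part of the loss that only involves the transmitted codewords
  set φ : U → V → S → X → ℝ := fun u v s x =>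
    ∑ y, kY x y * (ind (¬T u v y) + ∑ z, kZ u v y z * ind (Bad s x y z)) with hφ
  -- the loss caused by the competing codewords
  set ψ : M → (M → U × (Fin K → V)) → Fin K → X → ℝ := fun m c j x =>
    ∑ m', ∑ y, kY x y * (ind (m' ≠ m) * ind (T (c m').1 ((c m').2 j) y)) with hψ
  set df : U × (Fin K → V) → ℝ := fun c => ∑ s, max 0 (pS s - ∑ j, B c.1 (c.2 j) s / K) with hdf
  set dec : (M → U × (Fin K → V)) → Y → Fin K → M := fun c y j =>
    if h : ∃ m, T (c m).1 ((c m).2 j) y then h.choose else m₀ with hdec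
  have hdecle : ∀ c y j m, ind (dec c y j ≠ m) ≤ ind (¬T (c m).1 ((c m).2 j) y)
      + ∑ m', ind (m' ≠ m) * ind (T (c m').1 ((c m').2 j) y) := by
    intro c y j m
    have hs0 : ∀ m', 0 ≤ ind (m' ≠ m) * ind (T (c m').1 ((c m').2 j) y) := fun m' =>
      mul_nonneg (ind_nonneg _) (ind_nonneg _)
    by_cases hm : dec c y j = m
    · rw [ind_of_false (not_not.2 hm)]
      exact add_nonneg (ind_nonneg _) (Finset.sum_nonneg fun m' _ => hs0 m')
    · rw [ind_of_true hm]
      by_cases ht : T (c m).1 ((c m).2 j) y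
      · have hex : ∃ m, T (c m).1 ((c m).2 j) y := ⟨m, ht⟩
        have hd : dec c y j = hex.choose := by simp only [hdec]; rw [dif_pos hex]
        have h1 : T (c (dec c y j)).1 ((c (dec c y j)).2 j) y := by
          rw [hd]; exact hex.choose_spec
        have h2 := Finset.single_le_sum (fun m' _ => hs0 m') (Finset.mem_univ (dec c y j))
        rw [ind_of_true hm, ind_of_true h1, one_mul] at h2
        linarith [ind_nonneg (¬T (c m).1 ((c m).2 j) y)]
      · rw [ind_of_true ht]
        linarith [Finset.sum_nonneg fun m' (_ : m' ∈ Finset.univ) => hs0 m']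
  set κ : (M → U × (Fin K → V)) → Y → Fin K → Z → ℝ := fun c y j =>
    kZ (c (dec c y j)).1 ((c (dec c y j)).2 j) y with hκ
  have hloss : ∀ c (m : M) (s : S) (x : X) (j : Fin K),
      ∑ y, kY x y * ∑ z, κ c y j z * ind (dec c y j ≠ m ∨ Bad s x y z)
        ≤ φ (c m).1 ((c m).2 j) s x + ψ m c j x := by
    intro c m s x j
    simp only [hφ, hψ]
    rw [Finset.sum_comm (s := (Finset.univ : Finset M)), ← Finset.sum_add_distrib]
    simp_rw [← Finset.mul_sum, ← mul_add]
    refine Finset.sum_le_sum fun y _ => mul_le_mul_of_nonneg_left ?_ ((hkY x).1 y)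
    have h1 := hdecle c y j m
    have h2 : ∑ z, κ c y j z * ind (dec c y j ≠ m ∨ Bad s x y z)
        ≤ ind (dec c y j ≠ m) + ∑ z, kZ (c m).1 ((c m).2 j) y z * ind (Bad s x y z) := by
      by_cases hm : dec c y j = m
      · simp only [hκ, hm]
        rw [ind_of_false (by simp), zero_add]
        exact le_of_eq (by simp)
      · calc _ ≤ ∑ z, κ c y j z := Finset.sum_le_sum fun z _ =>
              mul_le_of_le_one_right ((hkZ _ _ _).1 z) (ind_le_one _)
          _ = ind (dec c y j ≠ m) := by rw [ind_of_true hm]; exact (hkZ _ _ _).2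
          _ ≤ _ := le_add_of_nonneg_right (Finset.sum_nonneg fun z _ =>
              mul_nonneg ((hkZ _ _ _).1 z) (ind_nonneg _))
    linarith
  -- the average over the codebook
  set R : (M → U × (Fin K → V)) → (S → U → X → ℝ) → ℝ := fun c w =>
    ∑ m, q m * (∑ s, ∑ j, B (c m).1 ((c m).2 j) s / K *
      ∑ x, w s (c m).1 x * (φ (c m).1 ((c m).2 j) s x + ψ m c j x) + df (c m)) with hR
  have hpi : IsPMF (fun c : M → U × (Fin K → V) => ∏ m, ν (c m)) := IsPMF.pi (fun _ => hνpmf)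
  have hα : ∀ j : Fin K, ∀ m, ∑ c : M → U × (Fin K → V), (∏ m, ν (c m)) *
      ∑ s, B (c m).1 ((c m).2 j) s * ∑ x, kX s (c m).1 x * φ (c m).1 ((c m).2 j) s x
        ≤ α₂ + α₃ := by
    intro j m
    rw [sum_pi_coord (k := fun _ : M => ν) (fun _ => hνpmf.2) m
      (fun a => ∑ s, B a.1 (a.2 j) s * ∑ x, kX s a.1 x * φ a.1 (a.2 j) s x)]
    simp only [hν]
    rw [sum_row_law hr' j (fun u v => ∑ s, B u v s * ∑ x, kX s u x * φ u v s x)]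
    simp only [hr, hBdef]
    have h3 : ∀ u, ∑ v, mixW pS (fun s => kV s u) v *
        ∑ s, bayes pS (fun s => kV s u) v s * ∑ x, kX s u x * φ u v s x
        = ∑ s, pS s * ∑ v, kV s u v * ∑ x, kX s u x * φ u v s x := fun u =>
      sum_mixW_mul_bayes hpS (fun s => hkV s u) (fun s v => ∑ x, kX s u x * φ u v s x)
    simp_rw [h3, hφ, mul_add, Finset.sum_add_distrib, mul_add, Finset.sum_add_distrib, mul_add,
      Finset.sum_add_distrib, mul_add, Finset.sum_add_distrib, mul_add, Finset.sum_add_distrib]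
    exact add_le_add hT hB
  have hpair : ∀ j : Fin K, ∀ m, ∑ c : M → U × (Fin K → V), (∏ m, ν (c m)) *
      ∑ s, B (c m).1 ((c m).2 j) s * ∑ x, kX s (c m).1 x * ψ m c j x
        ≤ (Fintype.card M - 1) * β := by
    intro j m
    have h4 : ∀ c : M → U × (Fin K → V), (∏ m, ν (c m)) *
        ∑ s, B (c m).1 ((c m).2 j) s * ∑ x, kX s (c m).1 x * ψ m c j x
        = ∑ m', ind (m' ≠ m) * ∑ y, (∏ m, ν (c m)) *
          ((∑ s, B (c m).1 ((c m).2 j) s * ∑ x, kX s (c m).1 x * kY x y) *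
            ind (T (c m').1 ((c m').2 j) y)) := by
      intro c
      simp only [hψ, Finset.mul_sum, Finset.sum_mul]
      simp_rw [Finset.sum_comm (s := (Finset.univ : Finset X)) (t := (Finset.univ : Finset M))]
      rw [Finset.sum_comm]
      refine Finset.sum_congr rfl fun m' _ => ?_
      simp_rw [Finset.sum_comm (s := (Finset.univ : Finset X)) (t := (Finset.univ : Finset Y))]
      rw [Finset.sum_comm]
      refine Finset.sum_congr rfl fun y _ => Finset.sum_congr rfl fun s _ =>
        Finset.sum_congr rfl fun x _ => by ring
    simp_rw [h4]
    rw [Finset.sum_comm]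
    calc _ ≤ ∑ m', ind (m' ≠ m) * β := by
          refine Finset.sum_le_sum fun m' _ => ?_
          rw [← Finset.mul_sum]
          by_cases hm : m' = m
          · rw [ind_of_false (not_not.2 hm)]; simp
          rw [ind_of_true hm, one_mul, one_mul, Finset.sum_comm]
          refine le_trans (le_of_eq (Finset.sum_congr rfl fun y _ => ?_)) hβ
          rw [sum_pi_coord_mul (k := fun _ : M => ν) (fun _ => hνpmf.2) (Ne.symm hm)
            (fun a => ∑ s, B a.1 (a.2 j) s * ∑ x, kX s a.1 x * kY x y)
            (fun a => ind (T a.1 (a.2 j) y))]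
          simp only [hν]
          rw [sum_row_law hr' j (fun u v => ∑ s, B u v s * ∑ x, kX s u x * kY x y),
            sum_row_law hr' j (fun u v => ind (T u v y))]
          congr 1
          refine Finset.sum_congr rfl fun u _ => ?_
          rw [sum_mixW_mul_bayes hpS (fun s => hkV s u) (fun s v => ∑ x, kX s u x * kY x y)]
      _ = (Fintype.card M - 1) * β := by
          rw [← Finset.sum_mul]
          congr 1
          have : ∀ m', ind (m' ≠ m) = 1 - ind (m' = m) := fun m' => by
            by_cases h : m' = m <;> simp [ind, h]
          simp_rw [this]
          rw [Finset.sum_sub_distrib]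
          simp [ind]
  have hcovm : ∀ m, ∑ c : M → U × (Fin K → V), (∏ m, ν (c m)) * df (c m) ≤ α₁ := by
    intro m
    rw [sum_pi_coord (k := fun _ : M => ν) (fun _ => hνpmf.2) m df]
    refine le_trans (le_of_eq ?_) hcov
    rw [Fintype.sum_prod_type]
    refine Finset.sum_congr rfl fun u _ => ?_
    rw [Finset.mul_sum]
    exact Finset.sum_congr rfl fun v _ => by simp only [hν, hdf, hr, hBdef]; ring
  have hRavg : ∑ c, (∏ m, ν (c m)) * R c kX ≤ α₁ + α₂ + (Fintype.card M - 1) * β + α₃ := by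
    have h5 : ∀ c, R c kX = ∑ m, q m * (∑ j : Fin K, (1 / K : ℝ) *
        (∑ s, B (c m).1 ((c m).2 j) s * ∑ x, kX s (c m).1 x * φ (c m).1 ((c m).2 j) s x
          + ∑ s, B (c m).1 ((c m).2 j) s * ∑ x, kX s (c m).1 x * ψ m c j x) + df (c m)) := by
      intro c
      simp only [hR]
      refine Finset.sum_congr rfl fun m _ => ?_
      congr 2
      rw [Finset.sum_comm]
      refine Finset.sum_congr rfl fun j _ => ?_
      rw [← Finset.sum_add_distrib, Finset.mul_sum]
      refine Finset.sum_congr rfl fun s _ => ?_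
      simp_rw [mul_add, Finset.sum_add_distrib]
      ring
    simp_rw [h5]
    have hunif : IsPMF (fun _ : Fin K => (1 / K : ℝ)) :=
      ⟨fun _ => by positivity, by simp [hK'.ne']⟩
    refine (sum_mul_sum_affine_le hq hunif (fun m j => hα j m) (fun m j => hpair j m)
      hcovm).trans (le_of_eq (by ring))
  obtain ⟨c, hc⟩ := hpi.exists_le (fun c => R c kX)
  -- the choice of the encoding functions
  have hθ : ∑ θ, τ θ * R c (fun s u x => ind (x = app θ s u)) = R c kX := by
    simp only [hR]
    rw [sum_mul_sum_affine hτ.2]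
    simp_rw [← happ]
    simp [ind]
  obtain ⟨θ, hθ'⟩ := hτ.exists_le (fun θ => R c (fun s u x => ind (x = app θ s u)))
  rw [hθ] at hθ'
  obtain ⟨F, g, hFg⟩ := exists_encoder_decoder (p := pS)
    (H := fun m s => kY (app θ s (c m).1)) (κ := κ c)
    (w := fun m s j => B (c m).1 ((c m).2 j) s / K)
    (E := fun m s y j z => ind (dec c y j ≠ m ∨ Bad s (app θ s (c m).1) y z))
    hq (fun m s => hkY _) (fun y j => hkZ _ _ _)
    (fun m s j => div_nonneg (hB0 _ _ _) hK'.le) (fun _ _ _ _ _ => ind_nonneg _)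
    (fun _ _ _ _ _ => ind_le_one _)
  refine ⟨fun m => (c m).1, θ, F, dec c, g, hFg.trans (le_trans ?_ ((hθ'.trans hc).trans hRavg))⟩
  simp only [hR]
  refine Finset.sum_le_sum fun m _ => mul_le_mul_of_nonneg_left ?_ (hq.1 m)
  rw [Finset.sum_add_distrib]
  refine add_le_add ?_ le_rfl
  refine Finset.sum_le_sum fun s _ => Finset.sum_le_sum fun j _ =>
    mul_le_mul_of_nonneg_left ?_ (div_nonneg (hB0 _ _ _) hK'.le)
  refine (hloss c m s (app θ s (c m).1) j).trans (le_of_eq ?_)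
  simp [ind]

theorem sum_arrow_prod {n : ℕ} {A B : Type*} [Fintype A] [Fintype B] (G : (Fin n → A × B) → ℝ) :
    ∑ w, G w = ∑ a : Fin n → A, ∑ b : Fin n → B, G (fun i => (a i, b i)) := by
  rw [← Fintype.sum_prod_type'
    (f := fun (a : Fin n → A) (b : Fin n → B) => G (fun i => (a i, b i)))]
  exact Fintype.sum_equiv (Equiv.arrowProdEquivProdArrow (Fin n) (fun _ => A) (fun _ => B)) _ _
    fun w => rfl

theorem sum_pi_mul {n : ℕ} {A : Type*} [Fintype A] (p k : Fin n → A → ℝ) :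
    ∑ a : Fin n → A, (∏ i, p i (a i)) * ∏ i, k i (a i) = ∏ i, ∑ a, p i a * k i a := by
  simp_rw [← Finset.prod_mul_distrib]
  exact (Fintype.prod_sum (fun i a => p i a * k i a)).symm

/-- Law of a coordinatewise function of independent random variables. -/
theorem sum_pi_map {n : ℕ} {A X : Type*} [Fintype A] [Fintype X] (τ : Fin n → A → ℝ)
    (h : Fin n → A → X) (F : (Fin n → X) → ℝ) :
    ∑ θ : Fin n → A, (∏ i, τ i (θ i)) * F (fun i => h i (θ i))
      = ∑ x : Fin n → X, (∏ i, ∑ t, τ i t * ind (h i t = x i)) * F x := by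
  simp_rw [← sum_pi_mul, Finset.sum_mul]
  rw [Finset.sum_comm]
  refine Finset.sum_congr rfl fun θ _ => ?_
  rw [Fintype.sum_eq_single (fun i => h i (θ i))]
  · rw [Finset.prod_eq_one (s := Finset.univ) (f := fun i => ind (h i (θ i) = h i (θ i)))
      fun i _ => ind_of_true rfl, mul_one]
  · intro x hx
    obtain ⟨i, hi⟩ : ∃ i, h i (θ i) ≠ x i := by
      by_contra! hcon
      exact hx (funext fun i => (hcon i).symm)
    rw [Finset.prod_eq_zero (f := fun i => ind (h i (θ i) = x i)) (Finset.mem_univ i)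
      (ind_of_false hi), mul_zero, zero_mul]

theorem sum_mul_ind_eq {A : Type*} [Fintype A] (F : A → ℝ) (a : A) :
    ∑ b, F b * ind (b = a) = F a := by
  rw [Fintype.sum_eq_single a fun b hb => by rw [ind_of_false hb, mul_zero],
    ind_of_true rfl, mul_one]

theorem margProb_eq_sum {Ω A : Type*} [Fintype Ω] (P : Ω → ℝ) (f : Ω → A) (a : A) :
    margProb P f a = ∑ ω, P ω * ind (f ω = a) := by
  unfold margProb prob
  refine Finset.sum_congr rfl fun ω _ => ?_
  by_cases h : f ω = a
  · rw [Set.indicator_of_mem (by exact h), ind_of_true h, mul_one]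
  · rw [Set.indicator_of_notMem (by exact h), ind_of_false h, mul_zero]

theorem margProb_nonneg {Ω A : Type*} [Fintype Ω] {P : Ω → ℝ} (hP : IsPMF P) (f : Ω → A) (a : A) :
    0 ≤ margProb P f a := by
  rw [margProb_eq_sum]
  exact Finset.sum_nonneg fun ω _ => mul_nonneg (hP.1 ω) (ind_nonneg _)

theorem le_margProb {Ω A : Type*} [Fintype Ω] {P : Ω → ℝ} (hP : IsPMF P) (f : Ω → A) (ω : Ω) :
    P ω ≤ margProb P f (f ω) := by
  rw [margProb_eq_sum]
  calc P ω = P ω * ind (f ω = f ω) := by rw [ind_of_true rfl, mul_one]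
    _ ≤ _ := Finset.single_le_sum (f := fun ω' => P ω' * ind (f ω' = f ω))
      (fun ω _ => mul_nonneg (hP.1 ω) (ind_nonneg _)) (Finset.mem_univ ω)

theorem sum_margProb_mul {Ω A : Type*} [Fintype Ω] [Fintype A] (P : Ω → ℝ) (f : Ω → A)
    (φ : A → ℝ) : ∑ a, margProb P f a * φ a = ∑ ω, P ω * φ (f ω) := by
  simp_rw [margProb_eq_sum, Finset.sum_mul]
  rw [Finset.sum_comm]
  refine Finset.sum_congr rfl fun ω _ => ?_
  simp_rw [mul_assoc]
  rw [← Finset.mul_sum, Fintype.sum_eq_single (f ω) fun a ha => by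
    rw [ind_of_false (Ne.symm ha), zero_mul], ind_of_true rfl, one_mul]

theorem isPMF_margProb {Ω A : Type*} [Fintype Ω] [Fintype A] {P : Ω → ℝ} (hP : IsPMF P)
    (f : Ω → A) : IsPMF (margProb P f) := by
  refine ⟨margProb_nonneg hP f, ?_⟩
  have := sum_margProb_mul P f (fun _ => 1)
  simpa [hP.2] using this

/-- Mutual information is the mean of the information density. -/
theorem mutInfo_eq_sum {Ω A B : Type*} [Fintype Ω] [Fintype A] [Fintype B] (P : Ω → ℝ)
    (f : Ω → A) (g : Ω → B) :
    mutInfo P f g = ∑ ω, P ω * Real.logb 2 (margProb P (fun ω => (f ω, g ω)) (f ω, g ω) /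
      (margProb P f (f ω) * margProb P g (g ω))) := by
  unfold mutInfo
  rw [← sum_margProb_mul P (fun ω => (f ω, g ω)) (fun c => Real.logb 2
    (margProb P (fun ω => (f ω, g ω)) c / (margProb P f c.1 * margProb P g c.2))),
    Fintype.sum_prod_type]

/-- With high probability a product of likelihood ratios does not exceed its typical value. -/
theorem eventually_prob_ratio_le {Ω : Type*} [Fintype Ω] {J : Ω → ℝ} (hJ : IsPMF J)
    {a b : Ω → ℝ} (ha : ∀ ω, 0 < J ω → 0 < a ω) (hb : ∀ ω, 0 < J ω → 0 < b ω) {η δ : ℝ}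
    (hη : 0 < η) (hδ : 0 < δ) :
    ∃ n₀ : ℕ, ∀ n ≥ n₀, ∑ w : Fin n → Ω, (∏ i, J (w i)) *
      ind ((2 : ℝ) ^ (n * (∑ ω, J ω * Real.logb 2 (a ω / b ω) + η)) * ∏ i, b (w i)
        < ∏ i, a (w i)) ≤ δ := by
  obtain ⟨n₀, h⟩ := eventually_prob_deviation_le hJ (fun ω => Real.logb 2 (a ω / b ω)) hη hδ
  refine ⟨n₀, fun n hn => le_trans (Finset.sum_le_sum fun w _ => ?_) (h n hn)⟩
  by_cases hw : ∀ i, 0 < J (w i)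
  · refine mul_le_mul_of_nonneg_left (ind_mono fun hlt => ?_) (Finset.prod_nonneg fun i _ => hJ.1 _)
    have hA : 0 < ∏ i, a (w i) := Finset.prod_pos fun i _ => ha _ (hw i)
    have hB : 0 < ∏ i, b (w i) := Finset.prod_pos fun i _ => hb _ (hw i)
    set μ := ∑ ω, J ω * Real.logb 2 (a ω / b ω)
    have h1 : (n : ℝ) * (μ + η) < ∑ i, Real.logb 2 (a (w i) / b (w i)) := by
      have h2 : (2 : ℝ) ^ (n * (μ + η)) < ∏ i, (a (w i) / b (w i)) := by
        rw [Finset.prod_div_distrib, lt_div_iff₀ hB]; exact hlt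
      have h3 := Real.logb_lt_logb (b := 2) (by norm_num) (by positivity) h2
      rw [Real.logb_rpow (by norm_num) (by norm_num), Real.logb_prod] at h3
      · exact h3
      · exact fun i _ => (div_pos (ha _ (hw i)) (hb _ (hw i))).ne'
    refine lt_of_lt_of_le ?_ (le_abs_self _)
    linarith
  · push Not at hw
    obtain ⟨i, hi⟩ := hw
    rw [Finset.prod_eq_zero (Finset.mem_univ i) (le_antisymm hi (hJ.1 _)), zero_mul, zero_mul]

/-- Total absolute deviation of the letter counts of `w` from those expected under `P`. -/
def countDev {A : Type*} [Fintype A] (P : A → ℝ) {n : ℕ} (w : Fin n → A) : ℝ :=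
  ∑ a, |∑ i, ind (w i = a) - n * P a|

theorem eventually_prob_countDev_le {Ω A : Type*} [Fintype Ω] [Fintype A] {J : Ω → ℝ}
    (hJ : IsPMF J) (f : Ω → A) {ε δ : ℝ} (hε : 0 < ε) (hδ : 0 < δ) :
    ∃ n₀ : ℕ, ∀ n ≥ n₀, ∑ w : Fin n → Ω, (∏ i, J (w i)) *
      ind (n * ε < countDev (margProb J f) (fun i => f (w i))) ≤ δ := by
  have hne : Nonempty A := hJ.nonempty.map f
  set c := (Fintype.card A : ℝ) with hc
  have hcpos : 0 < c := by rw [hc]; exact_mod_cast Fintype.card_pos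
  have h : ∀ a : A, ∃ n₀ : ℕ, ∀ n ≥ n₀, ∑ w : Fin n → Ω, (∏ i, J (w i)) *
      ind (n * (ε / c) < |∑ i, ind (f (w i) = a) - n * margProb J f a|) ≤ δ / c := by
    intro a
    rw [margProb_eq_sum]
    exact eventually_prob_deviation_le hJ (fun ω => ind (f ω = a)) (by positivity) (by positivity)
  choose N hN using h
  refine ⟨Finset.univ.sup N, fun n hn => ?_⟩
  calc _ ≤ ∑ w : Fin n → Ω, (∏ i, J (w i)) *
        ∑ a, ind (n * (ε / c) < |∑ i, ind (f (w i) = a) - n * margProb J f a|) := by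
        refine Finset.sum_le_sum fun w _ => mul_le_mul_of_nonneg_left ?_
          (Finset.prod_nonneg fun i _ => hJ.1 _)
        refine le_trans (ind_mono fun hlt => ?_) (ind_exists_le _)
        by_contra! hcon
        have := Finset.sum_le_sum fun a (_ : a ∈ Finset.univ) => hcon a
        rw [Finset.sum_const, Finset.card_univ, nsmul_eq_mul, ← hc] at this
        have h2 : c * (n * (ε / c)) = n * ε := by field_simp
        unfold countDev at hlt
        linarith
    _ = ∑ a, ∑ w : Fin n → Ω, (∏ i, J (w i)) *
        ind (n * (ε / c) < |∑ i, ind (f (w i) = a) - n * margProb J f a|) := by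
        simp_rw [Finset.mul_sum]
        rw [Finset.sum_comm]
    _ ≤ ∑ _a : A, δ / c := Finset.sum_le_sum fun a _ =>
        hN a n (le_trans (Finset.le_sup (Finset.mem_univ a)) hn)
    _ = δ := by
        rw [Finset.sum_const, Finset.card_univ, nsmul_eq_mul, ← hc]; field_simp

theorem ind_and (p q : Prop) : ind (p ∧ q) = ind p * ind q := by
  by_cases hp : p <;> by_cases hq : q <;> simp [ind, hp, hq]

theorem ind_mk_eq {A B : Type*} (a a' : A) (b b' : B) :
    ind ((a, b) = (a', b')) = ind (a = a') * ind (b = b') := by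
  rw [Prod.mk.injEq, ind_and]

theorem prod_mixW {U S V : Type*} [Fintype S] {pS : S → ℝ} {kV : S → U → V → ℝ} {n : ℕ}
    (u : Fin n → U) (v : Fin n → V) :
    mixW (fun s : Fin n → S => ∏ i, pS (s i)) (fun s v => ∏ i, kV (s i) (u i) (v i)) v
      = ∏ i, mixW pS (fun s => kV s (u i)) (v i) :=
  sum_pi_mul (fun _ => pS) fun i s => kV s (u i) (v i)

theorem prod_output_law {U S V X Y : Type*} [Fintype U] [Fintype S] [Fintype V] [Fintype X]
    {pU : U → ℝ} {pS : S → ℝ} {kV : S → U → V → ℝ} {kX : S → U → X → ℝ} {kY : X → Y → ℝ}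
    {n : ℕ} (y : Fin n → Y) :
    ∑ u : Fin n → U, (∏ i, pU (u i)) * ∑ s : Fin n → S, (∏ i, pS (s i)) *
        ∑ v : Fin n → V, (∏ i, kV (s i) (u i) (v i)) *
        ∑ x : Fin n → X, (∏ i, kX (s i) (u i) (x i)) * ∏ i, kY (x i) (y i)
      = ∏ i, ∑ u, pU u * ∑ s, pS s * ∑ v, kV s u v * ∑ x, kX s u x * kY x (y i) := by
  have hx := fun (s : Fin n → S) (u : Fin n → U) =>
    sum_pi_mul (fun i x => kX (s i) (u i) x) fun i x => kY x (y i)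
  have hv := fun (s : Fin n → S) (u : Fin n → U) => sum_pi_mul (fun i v => kV (s i) (u i) v)
    fun i _ => ∑ x, kX (s i) (u i) x * kY x (y i)
  have hs := fun u : Fin n → U => sum_pi_mul (fun _ s => pS s)
    fun i s => ∑ v, kV s (u i) v * ∑ x, kX s (u i) x * kY x (y i)
  simp_rw [hx, hv, hs]
  exact sum_pi_mul (fun _ => pU)
    fun i u => ∑ s, pS s * ∑ v, kV s u v * ∑ x, kX s u x * kY x (y i)

section JointLaw

variable {U S V X Y Z : Type*} [Fintype U] [Fintype S] [Fintype V] [Fintype X] [Fintype Y]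
  [Fintype Z]

/-- Joint law of the auxiliary variables, source, input, output and reconstruction. -/
def jointLaw (pU : U → ℝ) (pS : S → ℝ) (kV : S → U → V → ℝ) (kX : S → U → X → ℝ)
    (kY : X → Y → ℝ) (kZ : U → V → Y → Z → ℝ) : U × S × V × X × Y × Z → ℝ :=
  fun (u, s, v, x, y, z) => pU u * (pS s * (kV s u v * (kX s u x * (kY x y * kZ u v y z))))

variable {pU : U → ℝ} {pS : S → ℝ} {kV : S → U → V → ℝ} {kX : S → U → X → ℝ}
  {kY : X → Y → ℝ} {kZ : U → V → Y → Z → ℝ}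

theorem sum_jointLaw_mul (φ : U → S → V → X → Y → Z → ℝ) :
    ∑ ω : U × S × V × X × Y × Z, jointLaw pU pS kV kX kY kZ ω *
        φ ω.1 ω.2.1 ω.2.2.1 ω.2.2.2.1 ω.2.2.2.2.1 ω.2.2.2.2.2
      = ∑ u, pU u * ∑ s, pS s * ∑ v, kV s u v * ∑ x, kX s u x * ∑ y, kY x y *
        ∑ z, kZ u v y z * φ u s v x y z := by
  simp_rw [Fintype.sum_prod_type, jointLaw, mul_assoc, Finset.mul_sum]

theorem sum_prod_jointLaw_mul {n : ℕ} (φ : (Fin n → U) → (Fin n → S) → (Fin n → V) →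
      (Fin n → X) → (Fin n → Y) → (Fin n → Z) → ℝ) :
    ∑ w : Fin n → U × S × V × X × Y × Z, (∏ i, jointLaw pU pS kV kX kY kZ (w i)) *
        φ (fun i => (w i).1) (fun i => (w i).2.1) (fun i => (w i).2.2.1)
          (fun i => (w i).2.2.2.1) (fun i => (w i).2.2.2.2.1) (fun i => (w i).2.2.2.2.2)
      = ∑ u : Fin n → U, (∏ i, pU (u i)) * ∑ s : Fin n → S, (∏ i, pS (s i)) *
        ∑ v : Fin n → V, (∏ i, kV (s i) (u i) (v i)) *
        ∑ x : Fin n → X, (∏ i, kX (s i) (u i) (x i)) *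
        ∑ y : Fin n → Y, (∏ i, kY (x i) (y i)) *
        ∑ z : Fin n → Z, (∏ i, kZ (u i) (v i) (y i) (z i)) * φ u s v x y z := by
  simp_rw [sum_arrow_prod, jointLaw, Finset.prod_mul_distrib, mul_assoc, Finset.mul_sum]

theorem isPMF_jointLaw (hpU : IsPMF pU) (hpS : IsPMF pS) (hkV : ∀ s u, IsPMF (kV s u))
    (hkX : ∀ s u, IsPMF (kX s u)) (hkY : ∀ x, IsPMF (kY x)) (hkZ : ∀ u v y, IsPMF (kZ u v y)) :
    IsPMF (jointLaw pU pS kV kX kY kZ) := by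
  refine ⟨fun ω => mul_nonneg (hpU.1 _) (mul_nonneg (hpS.1 _) (mul_nonneg ((hkV _ _).1 _)
    (mul_nonneg ((hkX _ _).1 _) (mul_nonneg ((hkY _).1 _) ((hkZ _ _ _).1 _))))), ?_⟩
  have := sum_jointLaw_mul (pU := pU) (pS := pS) (kV := kV) (kX := kX) (kY := kY) (kZ := kZ)
    (fun _ _ _ _ _ _ => 1)
  simpa [(hkZ _ _ _).2, (hkY _).2, (hkX _ _).2, (hkV _ _).2, hpS.2, hpU.2] using this

theorem sum_jointLaw_mul_usv (hkX : ∀ s u, IsPMF (kX s u)) (hkY : ∀ x, IsPMF (kY x))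
    (hkZ : ∀ u v y, IsPMF (kZ u v y)) (φ : U → S → V → ℝ) :
    ∑ ω : U × S × V × X × Y × Z, jointLaw pU pS kV kX kY kZ ω * φ ω.1 ω.2.1 ω.2.2.1
      = ∑ u, pU u * ∑ s, pS s * ∑ v, kV s u v * φ u s v := by
  rw [sum_jointLaw_mul (fun u s v _ _ _ => φ u s v)]
  simp_rw [← Finset.sum_mul, (hkZ _ _ _).2, one_mul, ← Finset.sum_mul, (hkY _).2, one_mul,
    ← Finset.sum_mul, (hkX _ _).2, one_mul]

theorem margProb_jointLaw_s (hpU : IsPMF pU) (hkV : ∀ s u, IsPMF (kV s u))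
    (hkX : ∀ s u, IsPMF (kX s u)) (hkY : ∀ x, IsPMF (kY x))
    (hkZ : ∀ u v y, IsPMF (kZ u v y)) (s : S) :
    margProb (jointLaw pU pS kV kX kY kZ) (fun ω => ω.2.1) s = pS s := by
  rw [margProb_eq_sum, sum_jointLaw_mul_usv hkX hkY hkZ (fun _ s' _ => ind (s' = s))]
  simp_rw [← Finset.sum_mul, (hkV _ _).2, one_mul, sum_mul_ind_eq]
  rw [← Finset.sum_mul, hpU.2, one_mul]

theorem margProb_jointLaw_uv (hkX : ∀ s u, IsPMF (kX s u)) (hkY : ∀ x, IsPMF (kY x))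
    (hkZ : ∀ u v y, IsPMF (kZ u v y)) (u : U) (v : V) :
    margProb (jointLaw pU pS kV kX kY kZ) (fun ω => (ω.1, ω.2.2.1)) (u, v)
      = pU u * mixW pS (fun s => kV s u) v := by
  rw [margProb_eq_sum, sum_jointLaw_mul_usv hkX hkY hkZ (fun u' _ v' => ind ((u', v') = (u, v)))]
  have h : ∀ u' s' v', kV s' u' v' * ind ((u', v') = (u, v))
      = kV s' u' v' * ind (v' = v) * ind (u' = u) := fun u' s' v' => by
    rw [ind_mk_eq]; ring
  simp_rw [h, ← Finset.sum_mul, sum_mul_ind_eq, ← mul_assoc, ← Finset.sum_mul, ← mul_assoc,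
    sum_mul_ind_eq, mixW]

theorem margProb_jointLaw_uvs (hkX : ∀ s u, IsPMF (kX s u)) (hkY : ∀ x, IsPMF (kY x))
    (hkZ : ∀ u v y, IsPMF (kZ u v y)) (u : U) (v : V) (s : S) :
    margProb (jointLaw pU pS kV kX kY kZ) (fun ω => ((ω.1, ω.2.2.1), ω.2.1)) ((u, v), s)
      = pU u * (pS s * kV s u v) := by
  rw [margProb_eq_sum, sum_jointLaw_mul_usv hkX hkY hkZ
    (fun u' s' v' => ind (((u', v'), s') = ((u, v), s)))]
  have h : ∀ u' s' v', kV s' u' v' * ind (((u', v'), s') = ((u, v), s))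
      = kV s' u' v' * ind (v' = v) * (ind (s' = s) * ind (u' = u)) := fun u' s' v' => by
    rw [ind_mk_eq, ind_mk_eq]; ring
  simp_rw [h, ← Finset.sum_mul, sum_mul_ind_eq, ← mul_assoc, ← Finset.sum_mul, sum_mul_ind_eq,
    ← mul_assoc, sum_mul_ind_eq]

theorem margProb_jointLaw_y (hkZ : ∀ u v y, IsPMF (kZ u v y)) (y : Y) :
    margProb (jointLaw pU pS kV kX kY kZ) (fun ω => ω.2.2.2.2.1) y
      = ∑ u, pU u * ∑ s, pS s * ∑ v, kV s u v * ∑ x, kX s u x * kY x y := by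
  rw [margProb_eq_sum, sum_jointLaw_mul (fun _ _ _ _ y' _ => ind (y' = y))]
  have h : ∀ u v x, ∑ y', kY x y' * ∑ z, kZ u v y' z * ind (y' = y) = kY x y := fun u v x => by
    simp_rw [← Finset.sum_mul, (hkZ _ _ _).2, one_mul, sum_mul_ind_eq]
  simp_rw [h]

end JointLaw

/-- Expected shortfall, from the source law, of the average posterior given a random codebook of
`K` words of length `n`. -/
def coveringDefect {U S V : Type*} [Fintype U] [Fintype S] [Fintype V] (pU : U → ℝ) (pS : S → ℝ)
    (kV : S → U → V → ℝ) (n K : ℕ) : ℝ :=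
  ∑ u : Fin n → U, (∏ i, pU (u i)) * ∑ v : Fin K → Fin n → V,
    (∏ j, mixW (fun s : Fin n → S => ∏ i, pS (s i)) (fun s v => ∏ i, kV (s i) (u i) (v i)) (v j)) *
    ∑ s : Fin n → S, max 0 (∏ i, pS (s i) -
      ∑ j, bayes (fun s : Fin n → S => ∏ i, pS (s i)) (fun s v => ∏ i, kV (s i) (u i) (v i))
        (v j) s / K)

theorem pos_of_jointLaw_pos {U S V X Y Z : Type*} [Fintype U] [Fintype S] [Fintype V] {pU : U → ℝ}
    {pS : S → ℝ} {kV : S → U → V → ℝ} {kX : S → U → X → ℝ} {kY : X → Y → ℝ}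
    {kZ : U → V → Y → Z → ℝ} (hpU : IsPMF pU) (hpS : IsPMF pS) (hkV : ∀ s u, IsPMF (kV s u))
    {ω : U × S × V × X × Y × Z} (h : 0 < jointLaw pU pS kV kX kY kZ ω) :
    0 < pU ω.1 ∧ 0 < pS ω.2.1 ∧ 0 < kV ω.2.1 ω.1 ω.2.2.1 := by
  refine ⟨lt_of_le_of_ne (hpU.1 _) fun h0 => ?_, lt_of_le_of_ne (hpS.1 _) fun h0 => ?_,
    lt_of_le_of_ne ((hkV _ _).1 _) fun h0 => ?_⟩ <;>
  · simp [jointLaw, ← h0] at h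

section Typicality

variable {U S V X Y Z : Type*} [Fintype U] [Fintype S] [Fintype V] [Fintype X] [Fintype Y]
  [Fintype Z] {pU : U → ℝ} {pS : S → ℝ} {kV : S → U → V → ℝ} {kX : S → U → X → ℝ}
  {kY : X → Y → ℝ} {kZ : U → V → Y → Z → ℝ}

theorem sum_prod_jointLaw_mul_usv {n : ℕ} (hkX : ∀ s u, IsPMF (kX s u)) (hkY : ∀ x, IsPMF (kY x))
    (hkZ : ∀ u v y, IsPMF (kZ u v y))
    (φ : (Fin n → U) → (Fin n → S) → (Fin n → V) → ℝ) :
    ∑ w : Fin n → U × S × V × X × Y × Z, (∏ i, jointLaw pU pS kV kX kY kZ (w i)) *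
        φ (fun i => (w i).1) (fun i => (w i).2.1) (fun i => (w i).2.2.1)
      = ∑ u : Fin n → U, (∏ i, pU (u i)) * ∑ s : Fin n → S, (∏ i, pS (s i)) *
        ∑ v : Fin n → V, (∏ i, kV (s i) (u i) (v i)) * φ u s v := by
  rw [sum_prod_jointLaw_mul (fun u s v _ _ _ => φ u s v)]
  have hX := fun (s : Fin n → S) (u : Fin n → U) => (IsPMF.pi (fun i => hkX (s i) (u i))).2
  have hY := fun x : Fin n → X => (IsPMF.pi (fun i => hkY (x i))).2
  have hZ := fun (u : Fin n → U) (v : Fin n → V) (y : Fin n → Y) =>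
    (IsPMF.pi (fun i => hkZ (u i) (v i) (y i))).2
  simp_rw [← Finset.sum_mul, hZ, one_mul, ← Finset.sum_mul, hY, one_mul, ← Finset.sum_mul, hX,
    one_mul]

theorem sum_prod_jointLaw_mul_uvy {n : ℕ} (hkZ : ∀ u v y, IsPMF (kZ u v y))
    (φ : (Fin n → U) → (Fin n → V) → (Fin n → Y) → ℝ) :
    ∑ w : Fin n → U × S × V × X × Y × Z, (∏ i, jointLaw pU pS kV kX kY kZ (w i)) *
        φ (fun i => (w i).1) (fun i => (w i).2.2.1) (fun i => (w i).2.2.2.2.1)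
      = ∑ u : Fin n → U, (∏ i, pU (u i)) * ∑ s : Fin n → S, (∏ i, pS (s i)) *
        ∑ v : Fin n → V, (∏ i, kV (s i) (u i) (v i)) *
        ∑ x : Fin n → X, (∏ i, kX (s i) (u i) (x i)) *
        ∑ y : Fin n → Y, (∏ i, kY (x i) (y i)) * φ u v y := by
  rw [sum_prod_jointLaw_mul (fun u _ v _ y _ => φ u v y)]
  have hZ := fun (u : Fin n → U) (v : Fin n → V) (y : Fin n → Y) =>
    (IsPMF.pi (fun i => hkZ (u i) (v i) (y i))).2
  simp_rw [← Finset.sum_mul, hZ, one_mul]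

theorem eventually_coveringDefect_le (hpU : IsPMF pU) (hpS : IsPMF pS)
    (hkV : ∀ s u, IsPMF (kV s u)) (hkX : ∀ s u, IsPMF (kX s u)) (hkY : ∀ x, IsPMF (kY x))
    (hkZ : ∀ u v y, IsPMF (kZ u v y)) {η δ : ℝ} (hη : 0 < η) (hδ : 0 < δ) :
    ∃ n₀ : ℕ, ∀ n ≥ n₀, ∀ K : ℕ,
      (2 : ℝ) ^ (n * (mutInfo (jointLaw pU pS kV kX kY kZ) (fun ω => (ω.1, ω.2.2.1))
        (fun ω => ω.2.1) + η)) ≤ K → coveringDefect pU pS kV n K ≤ δ := by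
  set J := jointLaw pU pS kV kX kY kZ with hJdef
  have hJ : IsPMF J := isPMF_jointLaw hpU hpS hkV hkX hkY hkZ
  set I := mutInfo J (fun ω => (ω.1, ω.2.2.1)) (fun ω => ω.2.1) with hI
  have hmixpos : ∀ ω, 0 < J ω → 0 < mixW pS (fun s => kV s ω.1) ω.2.2.1 := by
    intro ω hω
    have h1 := le_margProb hJ (fun ω => (ω.1, ω.2.2.1)) ω
    rw [hJdef, margProb_jointLaw_uv hkX hkY hkZ, ← hJdef] at h1
    exact (pos_iff_pos_of_mul_pos (hω.trans_le h1)).1 (pos_of_jointLaw_pos hpU hpS hkV hω).1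
  have hmean : ∑ ω, J ω * Real.logb 2 (kV ω.2.1 ω.1 ω.2.2.1 /
      mixW pS (fun s => kV s ω.1) ω.2.2.1) = I := by
    rw [hI, mutInfo_eq_sum]
    refine Finset.sum_congr rfl fun ω _ => ?_
    rcases (hJ.1 ω).eq_or_lt with h0 | h0
    · rw [← h0, zero_mul, zero_mul]
    · obtain ⟨hu, hs, hv⟩ := pos_of_jointLaw_pos hpU hpS hkV h0
      have hm := hmixpos ω h0
      rw [hJdef, margProb_jointLaw_uvs hkX hkY hkZ, margProb_jointLaw_uv hkX hkY hkZ,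
        margProb_jointLaw_s hpU hkV hkX hkY hkZ]
      congr 2
      field_simp
  obtain ⟨n₁, h₁⟩ := eventually_prob_ratio_le hJ
    (a := fun ω => kV ω.2.1 ω.1 ω.2.2.1) (b := fun ω => mixW pS (fun s => kV s ω.1) ω.2.2.1)
    (fun ω hω => (pos_of_jointLaw_pos hpU hpS hkV hω).2.2) hmixpos (half_pos hη) (half_pos hδ)
  rw [hmean] at h₁
  obtain ⟨n₂, h₂⟩ := exists_nat_gt (-(2 * Real.logb 2 (δ / 2)) / (η / 2))
  refine ⟨max n₁ n₂, fun n hn K hK => ?_⟩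
  have hKpos : 0 < K := by
    have : (0 : ℝ) < K := lt_of_lt_of_le (by positivity) hK
    exact_mod_cast this
  set Γ : ℝ := (2 : ℝ) ^ (n * (I + η / 2)) with hΓ
  have hΓ0 : 0 < Γ := by positivity
  have hsqrt : √(Γ / K) ≤ δ / 2 := by
    rw [Real.sqrt_le_left (by positivity)]
    have hK' : (0 : ℝ) < K := by exact_mod_cast hKpos
    rw [div_le_iff₀ hK']
    have hn2 : (n₂ : ℝ) ≤ n := by exact_mod_cast le_trans (le_max_right _ _) hn
    have h3 : -(2 * Real.logb 2 (δ / 2)) ≤ n * (η / 2) := by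
      rw [div_lt_iff₀ (by positivity)] at h₂
      nlinarith
    have h4 : (2 : ℝ) ^ (-(n * (η / 2))) ≤ (δ / 2) ^ 2 := by
      rw [← Real.logb_le_logb (b := 2) (by norm_num) (by positivity) (by positivity),
        Real.logb_rpow (by norm_num) (by norm_num), Real.logb_pow]
      push_cast; linarith
    calc Γ = (2 : ℝ) ^ (-(n * (η / 2))) * (2 : ℝ) ^ (n * (I + η)) := by
          rw [hΓ, ← Real.rpow_add (by norm_num)]; congr 1; ring
      _ ≤ _ := mul_le_mul h4 hK (by positivity) (by positivity)
  unfold coveringDefect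
  calc _ ≤ ∑ u : Fin n → U, (∏ i, pU (u i)) * (∑ s : Fin n → S, (∏ i, pS (s i)) *
        ∑ v : Fin n → V, (∏ i, kV (s i) (u i) (v i)) *
          ind (Γ * ∏ i, mixW pS (fun s => kV s (u i)) (v i) < ∏ i, kV (s i) (u i) (v i))
          + δ / 2) := by
        refine Finset.sum_le_sum fun u _ => mul_le_mul_of_nonneg_left ?_
          (Finset.prod_nonneg fun i _ => hpU.1 _)
        have := soft_covering (p := fun s : Fin n → S => ∏ i, pS (s i))
          (k := fun s (v : Fin n → V) => ∏ i, kV (s i) (u i) (v i)) (IsPMF.pi fun _ => hpS)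
          (fun s => IsPMF.pi fun i => hkV (s i) (u i)) hKpos hΓ0.le
        simp_rw [prod_mixW] at this ⊢
        linarith
    _ = ∑ w : Fin n → U × S × V × X × Y × Z, (∏ i, J (w i)) *
          ind (Γ * ∏ i, mixW pS (fun s => kV s (w i).1) (w i).2.2.1
            < ∏ i, kV (w i).2.1 (w i).1 (w i).2.2.1) + δ / 2 := by
        simp_rw [mul_add]
        rw [Finset.sum_add_distrib, ← Finset.sum_mul, (IsPMF.pi fun _ => hpU).2, one_mul, hJdef,
          sum_prod_jointLaw_mul_usv hkX hkY hkZ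
            (fun (u : Fin n → U) (s : Fin n → S) (v : Fin n → V) =>
              ind (Γ * ∏ i, mixW pS (fun s => kV s (u i)) (v i) < ∏ i, kV (s i) (u i) (v i)))]
    _ ≤ δ / 2 + δ / 2 := by
        gcongr
        exact h₁ n (le_trans (le_max_left _ _) hn)
    _ = δ := add_halves δ

end Typicality

/-- Joint typicality test of a codeword pair and a channel output at information rate `R`. -/
def TypicalWith {Ω A B : Type*} [Fintype Ω] (J : Ω → ℝ) (f : Ω → A) (g : Ω → B) (R : ℝ) {n : ℕ}
    (a : Fin n → A) (b : Fin n → B) : Prop :=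
  (2 : ℝ) ^ (n * R) * ∏ i, (margProb J f (a i) * margProb J g (b i))
    ≤ ∏ i, margProb J (fun ω => (f ω, g ω)) (a i, b i)

theorem eventually_prob_not_typicalWith_le {Ω A B : Type*} [Fintype Ω] [Fintype A] [Fintype B]
    {J : Ω → ℝ} (hJ : IsPMF J) (f : Ω → A) (g : Ω → B) {η δ : ℝ} (hη : 0 < η) (hδ : 0 < δ) :
    ∃ n₀ : ℕ, ∀ n ≥ n₀, ∑ w : Fin n → Ω, (∏ i, J (w i)) *
      ind (¬TypicalWith J f g (mutInfo J f g - η) (fun i => f (w i)) (fun i => g (w i))) ≤ δ := by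
  obtain ⟨n₀, h⟩ := eventually_prob_ratio_le hJ
    (a := fun ω => margProb J f (f ω) * margProb J g (g ω))
    (b := fun ω => margProb J (fun ω => (f ω, g ω)) (f ω, g ω))
    (fun ω hω => mul_pos (hω.trans_le (le_margProb hJ f ω)) (hω.trans_le (le_margProb hJ g ω)))
    (fun ω hω => hω.trans_le (le_margProb hJ (fun ω => (f ω, g ω)) ω)) hη hδ
  refine ⟨n₀, fun n hn => le_trans (Finset.sum_le_sum fun w _ => mul_le_mul_of_nonneg_left
    (ind_mono fun hT => ?_) (Finset.prod_nonneg fun i _ => hJ.1 _)) (h n hn)⟩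
  have hmean : ∑ ω, J ω * Real.logb 2 (margProb J f (f ω) * margProb J g (g ω) /
      margProb J (fun ω => (f ω, g ω)) (f ω, g ω)) = -mutInfo J f g := by
    rw [mutInfo_eq_sum, ← Finset.sum_neg_distrib]
    refine Finset.sum_congr rfl fun ω _ => ?_
    rw [← mul_neg, ← Real.logb_inv, inv_div]
  rw [hmean]
  unfold TypicalWith at hT
  rw [not_le] at hT
  have h2 : (0 : ℝ) < (2 : ℝ) ^ (n * (-mutInfo J f g + η)) := by positivity
  have h3 := mul_lt_mul_of_pos_left hT h2
  rwa [← mul_assoc, ← Real.rpow_add (by norm_num), ← mul_add,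
    show -mutInfo J f g + η + (mutInfo J f g - η) = 0 by ring, mul_zero, Real.rpow_zero,
    one_mul] at h3

theorem sum_prob_typicalWith_le {Ω A B : Type*} [Fintype Ω] [Fintype A] [Fintype B]
    {J : Ω → ℝ} (hJ : IsPMF J) (f : Ω → A) (g : Ω → B) (R : ℝ) (n : ℕ) :
    ∑ b : Fin n → B, (∏ i, margProb J g (b i)) * ∑ a : Fin n → A, (∏ i, margProb J f (a i)) *
      ind (TypicalWith J f g R a b) ≤ (2 : ℝ) ^ (-(n * R)) := by
  have hp := (IsPMF.pi (ι := Fin n) fun _ => isPMF_margProb hJ fun ω => (f ω, g ω)).2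
  rw [sum_arrow_prod, Finset.sum_comm] at hp
  calc _ ≤ ∑ b : Fin n → B, ∑ a : Fin n → A, (2 : ℝ) ^ (-(n * R)) *
        ∏ i, margProb J (fun ω => (f ω, g ω)) (a i, b i) := by
        refine Finset.sum_le_sum fun b _ => ?_
        rw [Finset.mul_sum]
        refine Finset.sum_le_sum fun a _ => ?_
        have h0 : 0 ≤ ∏ i, margProb J (fun ω => (f ω, g ω)) (a i, b i) :=
          Finset.prod_nonneg fun i _ => margProb_nonneg hJ _ _
        by_cases hT : TypicalWith J f g R a b
        · rw [ind_of_true hT, mul_one, mul_comm, ← Finset.prod_mul_distrib]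
          have h2 : (0 : ℝ) < (2 : ℝ) ^ (-(n * R)) := by positivity
          have h3 := mul_le_mul_of_nonneg_left hT h2.le
          rwa [← mul_assoc, ← Real.rpow_add (by norm_num), neg_add_cancel, Real.rpow_zero,
            one_mul] at h3
        · rw [ind_of_false hT, mul_zero, mul_zero]
          positivity
    _ = (2 : ℝ) ^ (-(n * R)) := by simp_rw [← Finset.mul_sum, hp, mul_one]

/-- A causal block code of length `n` that starts afresh, conveys an index `F sⁿ` among `K` to the
decoder through a later block, and whose letter counts deviate from `P` by more than `d` with
probability at most `δ`. -/
def HasCode {S X Y Z : Type*} [Fintype S] [Fintype X] [Fintype Y] [Fintype Z] (pS : S → ℝ)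
    (kY : X → Y → ℝ) (P : S × X × Y × Z → ℝ) (n K : ℕ) (d δ : ℝ) : Prop :=
  ∃ (f : Fin n → (Fin n → S) → X) (F : (Fin n → S) → Fin K)
    (g : (Fin n → Y) → Fin K → Fin n → Z), EncOK .causal f ∧
    ∑ s : Fin n → S, (∏ i, pS (s i)) * ∑ y : Fin n → Y, (∏ i, kY (f i s) (y i)) *
      ind (d < countDev P fun i => (s i, f i s, y i, g y (F s) i)) ≤ δ

/-- Like `HasCode`, but the block also conveys a message among `M`, of arbitrary law, which the
decoder recovers once it knows the index. -/
def HasBlockCode {S X Y Z : Type*} [Fintype S] [Fintype X] [Fintype Y] [Fintype Z] (pS : S → ℝ)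
    (kY : X → Y → ℝ) (P : S × X × Y × Z → ℝ) (n M K : ℕ) (d δ : ℝ) : Prop :=
  ∀ q : Fin M → ℝ, IsPMF q →
    ∃ (f : Fin M → Fin n → (Fin n → S) → X) (F : Fin M → (Fin n → S) → Fin K)
      (dec : (Fin n → Y) → Fin K → Fin M) (g : (Fin n → Y) → Fin K → Fin n → Z),
      (∀ m, EncOK .causal (f m)) ∧
      ∑ m, q m * ∑ s : Fin n → S, (∏ i, pS (s i)) * ∑ y : Fin n → Y, (∏ i, kY (f m i s) (y i)) *
        ind (dec y (F m s) ≠ m ∨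
          d < countDev P fun i => (s i, f m i s, y i, g y (F m s) i)) ≤ δ

section BlockCode

variable {U S V X Y Z : Type*} [Fintype U] [Fintype S] [Fintype V] [Fintype X] [Fintype Y]
  [Fintype Z] {pU : U → ℝ} {pS : S → ℝ} {kV : S → U → V → ℝ} {kX : S → U → X → ℝ}
  {kY : X → Y → ℝ} {kZ : U → V → Y → Z → ℝ}

theorem eventually_hasBlockCode (hpU : IsPMF pU) (hpS : IsPMF pS)
    (hkV : ∀ s u, IsPMF (kV s u)) (hkX : ∀ s u, IsPMF (kX s u)) (hkY : ∀ x, IsPMF (kY x))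
    (hkZ : ∀ u v y, IsPMF (kZ u v y)) {η δ : ℝ} (hη : 0 < η) (hδ : 0 < δ) :
    ∃ n₀ : ℕ, ∀ n ≥ n₀, ∀ (M K : ℕ) (P : S × X × Y × Z → ℝ) (d : ℝ), 0 < K →
      ((M : ℝ) - 1) * (2 : ℝ) ^ (-(n * (mutInfo (jointLaw pU pS kV kX kY kZ)
        (fun ω => (ω.1, ω.2.2.1)) (fun ω => ω.2.2.2.2.1) - η))) ≤ δ →
      coveringDefect pU pS kV n K ≤ δ →
      ∑ w : Fin n → U × S × V × X × Y × Z, (∏ i, jointLaw pU pS kV kX kY kZ (w i)) *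
        ind (d < countDev P fun i =>
          ((w i).2.1, (w i).2.2.2.1, (w i).2.2.2.2.1, (w i).2.2.2.2.2)) ≤ δ →
      HasBlockCode pS kY P n M K d (4 * δ) := by
  classical
  set J := jointLaw pU pS kV kX kY kZ with hJdef
  have hJ : IsPMF J := isPMF_jointLaw hpU hpS hkV hkX hkY hkZ
  set I := mutInfo J (fun ω => (ω.1, ω.2.2.1)) (fun ω => ω.2.2.2.2.1) with hI
  obtain ⟨n₀, h₀⟩ := eventually_prob_not_typicalWith_le hJ (fun ω => (ω.1, ω.2.2.1))
    (fun ω => ω.2.2.2.2.1) hη hδ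
  refine ⟨n₀, fun n hn M K P d hK hM hcov hdev q hq => ?_⟩
  have hT := h₀ n hn
  rw [hJdef, sum_prod_jointLaw_mul_uvy hkZ (fun (u : Fin n → U) (v : Fin n → V) (y : Fin n → Y) =>
    ind (¬TypicalWith J (fun ω => (ω.1, ω.2.2.1)) (fun ω => ω.2.2.2.2.1) (I - η)
      (fun i => (u i, v i)) y))] at hT
  have hβ := sum_prob_typicalWith_le hJ (fun ω => (ω.1, ω.2.2.1)) (fun ω => ω.2.2.2.2.1) (I - η) n
  rw [hJdef, sum_prod_jointLaw_mul (fun (u : Fin n → U) (s : Fin n → S) (v : Fin n → V)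
    (x : Fin n → X) (y : Fin n → Y) (z : Fin n → Z) =>
    ind (d < countDev P fun i => (s i, x i, y i, z i)))] at hdev
  have hcode := exists_one_shot_code (M := Fin M) (S := Fin n → S) (U := Fin n → U)
    (V := Fin n → V) (X := Fin n → X) (Y := Fin n → Y) (Z := Fin n → Z)
    (Θ := Fin n → S × U → X) hK
    (pS := fun s => ∏ i, pS (s i)) (pU := fun u => ∏ i, pU (u i))
    (kV := fun s u v => ∏ i, kV (s i) (u i) (v i)) (kX := fun s u x => ∏ i, kX (s i) (u i) (x i))
    (kY := fun x y => ∏ i, kY (x i) (y i)) (kZ := fun u v y z => ∏ i, kZ (u i) (v i) (y i) (z i))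
    (τ := fun θ => ∏ i, ∏ c, kX c.1 c.2 (θ i c)) (app := fun θ s u i => θ i (s i, u i))
    (IsPMF.pi fun _ => hpS) (IsPMF.pi fun _ => hpU) (fun s u => IsPMF.pi fun i => hkV _ _)
    (fun x => IsPMF.pi fun i => hkY _) (fun u v y => IsPMF.pi fun i => hkZ _ _ _)
    (IsPMF.pi fun _ => IsPMF.pi fun c : S × U => hkX c.1 c.2)
    (fun s u F => by
      rw [sum_pi_map (fun _ (t : S × U → X) => ∏ c : S × U, kX c.1 c.2 (t c))
        (fun i t => t (s i, u i)) F]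
      refine Finset.sum_congr rfl fun x _ => ?_
      congr 1
      refine Finset.prod_congr rfl fun i _ => ?_
      rw [sum_pi_coord (k := fun c : S × U => kX c.1 c.2) (fun c => (hkX _ _).2) (s i, u i)
        (fun t => ind (t = x i)), sum_mul_ind_eq])
    (fun u v y => TypicalWith J (fun ω => (ω.1, ω.2.2.1)) (fun ω => ω.2.2.2.2.1) (I - η)
      (fun i => (u i, v i)) y)
    (fun s x y z => d < countDev P fun i => (s i, x i, y i, z i))
    (α₁ := δ) (α₂ := δ) (α₃ := δ) (β := (2 : ℝ) ^ (-(n * (I - η)))) hcov hT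
    (by
      refine le_of_eq_of_le ?_ hβ
      refine Finset.sum_congr rfl fun y _ => ?_
      rw [prod_output_law]
      congr 1
      · exact Finset.prod_congr rfl fun i _ => (margProb_jointLaw_y hkZ _).symm
      · rw [sum_arrow_prod]
        refine Finset.sum_congr rfl fun u _ => ?_
        rw [Finset.mul_sum]
        refine Finset.sum_congr rfl fun v _ => ?_
        rw [prod_mixW, ← mul_assoc, ← Finset.prod_mul_distrib]
        congr 1
        exact Finset.prod_congr rfl fun i _ => (margProb_jointLaw_uv hkX hkY hkZ _ _).symm)
    hdev hq
  obtain ⟨u, θ, F, dec, g, h⟩ := hcode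
  refine ⟨fun m i s => θ i (s i, u m i), F, dec, g, fun m i s s' hss => ?_, h.trans ?_⟩
  · simp only [hss i le_rfl]
  · rw [Fintype.card_fin]
    linarith

end BlockCode

theorem sum_append {n m : ℕ} {A : Type*} [Fintype A] (G : (Fin (n + m) → A) → ℝ) :
    ∑ w, G w = ∑ a : Fin n → A, ∑ b : Fin m → A, G (Fin.append a b) := by
  rw [← Fintype.sum_prod_type' (f := fun (a : Fin n → A) (b : Fin m → A) => G (Fin.append a b))]
  exact (Fintype.sum_equiv (Fin.appendEquiv n m) _ _ fun w => rfl).symm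

theorem countDev_add_le {A : Type*} [Fintype A] (P : A → ℝ) {n m : ℕ} (w : Fin (n + m) → A) :
    countDev P w ≤ countDev P (fun i => w (Fin.castAdd m i)) +
      countDev P (fun i => w (Fin.natAdd n i)) := by
  unfold countDev
  rw [← Finset.sum_add_distrib]
  refine Finset.sum_le_sum fun a _ => ?_
  rw [Fin.sum_univ_add]
  push_cast
  refine le_of_eq_of_le ?_ (abs_add_le _ _)
  congr 1
  ring

theorem sum_two_stage {A₁ A₂ B₁ B₂ : Type*} [Fintype A₁] [Fintype A₂] [Fintype B₁] [Fintype B₂]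
    {p₁ : A₁ → ℝ} {p₂ : A₂ → ℝ} {k₁ : A₁ → B₁ → ℝ} {k₂ : A₁ → A₂ → B₂ → ℝ}
    (hp₂ : ∑ a, p₂ a = 1) (hk₁ : ∀ a, ∑ b, k₁ a b = 1) (hk₂ : ∀ a a', ∑ b, k₂ a a' b = 1)
    (G : A₁ → B₁ → ℝ) (H : A₁ → A₂ → B₂ → ℝ) :
    ∑ a₁, ∑ a₂, (p₁ a₁ * p₂ a₂) * ∑ b₁, ∑ b₂, (k₁ a₁ b₁ * k₂ a₁ a₂ b₂) *
        (G a₁ b₁ + H a₁ a₂ b₂)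
      = ∑ a₁, p₁ a₁ * ∑ b₁, k₁ a₁ b₁ * G a₁ b₁
        + ∑ a₁, p₁ a₁ * ∑ a₂, p₂ a₂ * ∑ b₂, k₂ a₁ a₂ b₂ * H a₁ a₂ b₂ := by
  have hin : ∀ a₁ a₂, ∑ b₁, ∑ b₂, (k₁ a₁ b₁ * k₂ a₁ a₂ b₂) * (G a₁ b₁ + H a₁ a₂ b₂)
      = ∑ b₁, k₁ a₁ b₁ * G a₁ b₁ + ∑ b₂, k₂ a₁ a₂ b₂ * H a₁ a₂ b₂ := by
    intro a₁ a₂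
    have h1 : ∀ b₁, ∑ b₂, (k₁ a₁ b₁ * k₂ a₁ a₂ b₂) * (G a₁ b₁ + H a₁ a₂ b₂)
        = k₁ a₁ b₁ * G a₁ b₁ + k₁ a₁ b₁ * ∑ b₂, k₂ a₁ a₂ b₂ * H a₁ a₂ b₂ := by
      intro b₁
      calc _ = (∑ b₂, k₂ a₁ a₂ b₂) * (k₁ a₁ b₁ * G a₁ b₁)
            + k₁ a₁ b₁ * ∑ b₂, k₂ a₁ a₂ b₂ * H a₁ a₂ b₂ := by
            rw [Finset.sum_mul, Finset.mul_sum, ← Finset.sum_add_distrib]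
            exact Finset.sum_congr rfl fun b₂ _ => by ring
        _ = _ := by rw [hk₂, one_mul]
    simp_rw [h1]
    rw [Finset.sum_add_distrib, ← Finset.sum_mul, hk₁, one_mul]
  simp_rw [hin]
  rw [← Finset.sum_add_distrib]
  refine Finset.sum_congr rfl fun a₁ _ => ?_
  simp_rw [mul_assoc, mul_add]
  rw [Finset.sum_add_distrib, ← Finset.mul_sum, ← Finset.mul_sum, ← Finset.sum_mul, hp₂, one_mul]

/-- Appending a block that conveys the index left open by the preceding code. -/
theorem HasCode.append {S X Y Z : Type*} [Fintype S] [Fintype X] [Fintype Y] [Fintype Z]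
    {pS : S → ℝ} {kY : X → Y → ℝ} (hpS : IsPMF pS) (hkY : ∀ x, IsPMF (kY x))
    {P : S × X × Y × Z → ℝ} {n n' M K : ℕ} {d d' δ δ' : ℝ} (h : HasCode pS kY P n M d δ)
    (h' : HasBlockCode pS kY P n' M K d' δ') :
    HasCode pS kY P (n + n') K (d + d') (δ + δ') := by
  obtain ⟨f, F, g, hf, hδ⟩ := h
  have hpn : IsPMF fun s : Fin n → S => ∏ i, pS (s i) := IsPMF.pi fun _ => hpS
  obtain ⟨f', F', dec, g', hf', hδ'⟩ := h' (margProb (fun s : Fin n → S => ∏ i, pS (s i)) F)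
    (isPMF_margProb hpn F)
  rw [sum_margProb_mul] at hδ'
  refine ⟨fun i s => Fin.append (fun i => f i fun j => s (Fin.castAdd n' j))
      (fun i => f' (F fun j => s (Fin.castAdd n' j)) i fun j => s (Fin.natAdd n j)) i,
    fun s => F' (F fun j => s (Fin.castAdd n' j)) fun j => s (Fin.natAdd n j),
    fun y k => Fin.append
      (g (fun j => y (Fin.castAdd n' j)) (dec (fun j => y (Fin.natAdd n j)) k))
      (g' (fun j => y (Fin.natAdd n j)) k), ?_, ?_⟩
  · intro i s s' hss
    induction i using Fin.addCases with
    | left i =>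
      simp only [Fin.append_left]
      exact hf i _ _ fun j hj => hss _ (Fin.le_def.2 (Fin.le_def.1 hj))
    | right i =>
      simp only [Fin.append_right]
      have h1 : (fun j => s (Fin.castAdd n' j)) = fun j => s' (Fin.castAdd n' j) :=
        funext fun j => hss _ (by rw [Fin.le_def]; simp; omega)
      rw [h1]
      exact hf' _ i _ _ fun j hj => hss _ (by simpa using hj)
  · rw [sum_append]
    simp_rw [sum_append (A := Y), Fin.prod_univ_add, Fin.append_left, Fin.append_right]
    refine le_trans ?_ (add_le_add hδ hδ')
    rw [← sum_two_stage (p₂ := fun s : Fin n' → S => ∏ i, pS (s i))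
      (IsPMF.pi fun _ => hpS).2 (fun s => (IsPMF.pi fun i => hkY (f i s)).2)
      (fun s s' => (IsPMF.pi fun i => hkY (f' (F s) i s')).2)]
    refine Finset.sum_le_sum fun s _ => Finset.sum_le_sum fun s' _ => mul_le_mul_of_nonneg_left ?_
      (mul_nonneg (hpn.1 s) ((IsPMF.pi fun _ => hpS).1 s'))
    refine Finset.sum_le_sum fun y _ => Finset.sum_le_sum fun y' _ => mul_le_mul_of_nonneg_left ?_
      (mul_nonneg ((IsPMF.pi fun i => hkY (f i s)).1 y)
        ((IsPMF.pi fun i => hkY (f' (F s) i s')).1 y'))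
    refine le_trans (ind_mono fun hlt => ?_) (ind_or_le _ _)
    by_contra hcon
    push Not at hcon
    obtain ⟨h1, h2, h3⟩ := hcon
    have h4 := countDev_add_le P (fun i => (Fin.append s s' i,
      Fin.append (fun i => f i s) (fun i => f' (F s) i s') i, Fin.append y y' i,
      Fin.append (g y (dec y' (F' (F s) s'))) (g' y' (F' (F s) s')) i))
    simp only [Fin.append_left, Fin.append_right, h2] at h4
    rw [h2] at hlt
    linarith

theorem hasCode_zero {S X Y Z : Type*} [Fintype S] [Fintype X] [Fintype Y] [Fintype Z]
    (pS : S → ℝ) (kY : X → Y → ℝ) (P : S × X × Y × Z → ℝ) : HasCode pS kY P 0 1 0 0 := by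
  refine ⟨fun i => i.elim0, fun _ => 0, fun _ _ i => i.elim0, fun i => i.elim0, ?_⟩
  refine le_of_eq (Finset.sum_eq_zero fun s _ => mul_eq_zero_of_right _
    (Finset.sum_eq_zero fun y _ => mul_eq_zero_of_right _ (ind_of_false ?_)))
  simp [countDev]

theorem tvDist_empDist {A : Type*} [Fintype A] (P : A → ℝ) {n : ℕ} (hn : 0 < n) (w : Fin n → A) :
    tvDist (empDist w) P = countDev P w / (2 * n) := by
  have hn' : (0 : ℝ) < n := by exact_mod_cast hn
  have h : ∀ a, |empDist w a - P a| = |∑ i, ind (w i = a) - n * P a| / n := by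
    intro a
    have h1 : empDist w a = (∑ i, ind (w i = a)) / n := by
      unfold empDist
      congr 1
    rw [h1, show (∑ i, ind (w i = a)) / (n : ℝ) - P a = (∑ i, ind (w i = a) - n * P a) / n by
      field_simp, abs_div, abs_of_pos hn']
  unfold tvDist countDev
  simp_rw [h]
  rw [← Finset.sum_div, div_div, mul_comm (n : ℝ) 2]

/-- Codes with small deviation rate and a trivial terminal index witness achievability. -/
theorem achievable_of_hasCode {S X Y Z : Type*} [Fintype S] [Fintype X] [Fintype Y] [Fintype Z]
    {pS : S → ℝ} {kY : X → Y → ℝ} (hpS : IsPMF pS) (hkY : ∀ x, IsPMF (kY x))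
    {P : S × X × Y × Z → ℝ}
    (h : ∀ ε : ℝ, 0 < ε → ∃ (n : ℕ) (d δ : ℝ), 0 < n ∧ d ≤ n * (2 * ε) ∧ δ < ε ∧
      HasCode pS kY P n 1 d δ) :
    Achievable pS kY EncoderClass.causal P := by
  intro ε hε
  obtain ⟨n, d, δ, hn, hd, hδ, f, F, g, hf, hle⟩ := h ε hε
  refine ⟨n, hn, f, fun i y => g y 0 i, hf, lt_of_le_of_lt ?_ hδ⟩
  refine le_trans ?_ hle
  have hn' : (0 : ℝ) < n := by exact_mod_cast hn
  unfold prob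
  rw [Fintype.sum_prod_type]
  refine Finset.sum_le_sum fun s _ => ?_
  rw [Finset.mul_sum]
  refine Finset.sum_le_sum fun y _ => ?_
  have h0 : 0 ≤ (∏ i, pS (s i)) * ∏ i, kY (f i s) (y i) :=
    mul_nonneg ((IsPMF.pi fun _ => hpS).1 s) ((IsPMF.pi fun i => hkY (f i s)).1 y)
  rw [← mul_assoc]
  by_cases hE : ε < tvDist (empDist fun i => (s i, f i s, y i, g y 0 i)) P
  · rw [Set.indicator_of_mem (by exact hE), ind_of_true, mul_one]
    · rfl
    · rw [tvDist_empDist P hn, lt_div_iff₀ (by positivity)] at hE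
      rw [Subsingleton.elim (F s) 0]
      linarith
  · rw [Set.indicator_of_notMem (by exact hE)]
    exact mul_nonneg h0 (ind_nonneg _)

theorem eventually_two_rpow_neg_le {I δ : ℝ} (hI : 0 < I) (hδ : 0 < δ) :
    ∃ k₀ : ℕ, ∀ k ≥ k₀, (2 : ℝ) ^ (-(k * I)) ≤ δ := by
  obtain ⟨k₀, hk₀⟩ := exists_nat_gt (-Real.logb 2 δ / I)
  refine ⟨k₀, fun k hk => ?_⟩
  have h1 : (k₀ : ℝ) ≤ k := by exact_mod_cast hk
  rw [div_lt_iff₀ hI] at hk₀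
  rw [← Real.logb_le_logb (b := 2) (by norm_num) (by positivity) hδ,
    Real.logb_rpow (by norm_num) (by norm_num)]
  nlinarith

/-- Chaining blocks of slowly growing lengths, the index left open by one block being conveyed by
the next, and terminating with a plain channel code. -/
theorem achievable_of_block_codes {S X Y Z : Type*} [Fintype S] [Fintype X] [Fintype Y] [Fintype Z]
    {pS : S → ℝ} {kY : X → Y → ℝ} (hpS : IsPMF pS) (hkY : ∀ x, IsPMF (kY x))
    {P : S × X × Y × Z → ℝ} {I C : ℝ} (hI : 0 < I) (hC : 0 < C)
    (hmain : ∀ η ε δ : ℝ, 0 < η → 0 < ε → 0 < δ → ∃ n₀ : ℕ, ∀ n ≥ n₀, ∀ M K : ℕ,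
      ((M : ℝ) - 1) * (2 : ℝ) ^ (-(n * (I - η))) ≤ δ → (2 : ℝ) ^ (n * (I + η)) ≤ K →
      HasBlockCode pS kY P n M K (n * ε) δ)
    (hlast : ∀ δ : ℝ, 0 < δ → ∃ n₀ : ℕ, ∀ n ≥ n₀, ∀ M : ℕ,
      ((M : ℝ) - 1) * (2 : ℝ) ^ (-(n * C)) ≤ δ → HasBlockCode pS kY P n M 1 (2 * n) δ) :
    Achievable pS kY EncoderClass.causal P := by
  refine achievable_of_hasCode hpS hkY fun ε hε => ?_
  obtain ⟨c, hc⟩ := exists_nat_gt (5 * I / C)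
  rw [div_lt_iff₀ hC] at hc
  obtain ⟨B₀, hB₀⟩ := exists_nat_gt (2 * c / ε)
  rw [div_lt_iff₀ hε] at hB₀
  set B : ℕ := B₀ + 1 with hB
  have hB1 : (1 : ℝ) ≤ B := by rw [hB]; push_cast; linarith [Nat.cast_nonneg (α := ℝ) B₀]
  have hcB : 2 * (c : ℝ) ≤ ε * B := by rw [hB]; push_cast; nlinarith
  have hc0 : 0 < (c : ℝ) := by
    by_contra! hcon
    nlinarith
  set η : ℝ := I / (8 * B) with hη
  have hη0 : 0 < η := by positivity
  have hηB : B * η = I / 8 := by rw [hη]; field_simp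
  set δ : ℝ := ε / (2 * (B + 1)) with hδ
  have hδ0 : 0 < δ := by positivity
  obtain ⟨n₁, h₁⟩ := hmain η ε δ hη0 hε hδ0
  obtain ⟨n₂, h₂⟩ := hlast δ hδ0
  obtain ⟨k₀, hk₀⟩ := eventually_two_rpow_neg_le (half_pos hI) hδ0
  set k : ℕ := n₁ + n₂ + k₀ + 1 with hk
  have hkδ := hk₀ k (by omega)
  have hk0 : (0 : ℝ) < k := by rw [hk]; positivity
  set idx : ℕ → ℕ := fun b => if b = 0 then 1 else
    ⌈(2 : ℝ) ^ ((((B : ℝ) + b - 1) * k) * (I + η))⌉₊ with hidx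
  have hidx_le : ∀ b, (idx b : ℝ) - 1 ≤ (2 : ℝ) ^ ((((B : ℝ) + b - 1) * k) * (I + η)) := by
    intro b
    by_cases hb : b = 0
    · simp only [hidx, hb, if_true, Nat.cast_one, sub_self]
      positivity
    · simp only [hidx, hb, if_false]
      linarith [Nat.ceil_lt_add_one (a := (2 : ℝ) ^ ((((B : ℝ) + b - 1) * k) * (I + η)))
        (by positivity)]
  have hidx_ge : ∀ b, (2 : ℝ) ^ (((B + b) * k : ℕ) * (I + η)) ≤ idx (b + 1) := by
    intro b
    simp only [hidx, Nat.add_eq_zero_iff, one_ne_zero, and_false, if_false]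
    refine le_of_eq_of_le ?_ (Nat.le_ceil _)
    congr 2
    push_cast
    ring
  have hrate : ∀ (b : ℕ) (x : ℝ), ((B : ℝ) + b - 1) * k * (I + η) - x ≤ -(k * (I / 2)) →
      ((idx b : ℝ) - 1) * (2 : ℝ) ^ (-x) ≤ δ := by
    intro b x hx
    calc _ ≤ (2 : ℝ) ^ ((((B : ℝ) + b - 1) * k) * (I + η)) * (2 : ℝ) ^ (-x) :=
          mul_le_mul_of_nonneg_right (hidx_le b) (by positivity)
      _ = (2 : ℝ) ^ (((B : ℝ) + b - 1) * k * (I + η) - x) := by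
          rw [← Real.rpow_add (by norm_num), ← sub_eq_add_neg]
      _ ≤ (2 : ℝ) ^ (-(k * (I / 2))) := Real.rpow_le_rpow_of_exponent_le (by norm_num) hx
      _ ≤ δ := hkδ
  have hchain : ∀ b ≤ B, HasCode pS kY P (∑ j ∈ Finset.range b, (B + j) * k) (idx b)
      ((∑ j ∈ Finset.range b, (B + j) * k : ℕ) * ε) (b * δ) := by
    intro b
    induction b with
    | zero =>
      intro _
      simpa [hidx] using hasCode_zero pS kY P
    | succ b ih =>
      intro hb
      have hbB : (b : ℝ) + 1 ≤ B := by exact_mod_cast hb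
      have hblock := h₁ ((B + b) * k) (by nlinarith) (idx b) (idx (b + 1))
        (hrate b _ (by
          push_cast
          have h3 : ((B : ℝ) + b) * (2 * η) ≤ 2 * B * (2 * η) :=
            mul_le_mul_of_nonneg_right (by linarith) (by positivity)
          have h4 : k * (((B : ℝ) + b) * (2 * η)) ≤ k * (I / 2) :=
            mul_le_mul_of_nonneg_left (by linarith) hk0.le
          have h5 : 0 < k * η := by positivity
          linarith)) (hidx_ge b)
      have := (ih (by omega)).append hpS hkY hblock
      rw [Finset.sum_range_succ]
      convert this using 1
      · push_cast; ring
      · push_cast; ring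
  have hfinal := h₂ (k * B * c) (by
      have hc1 : 1 ≤ c := by exact_mod_cast hc0
      have : k * 1 * 1 ≤ k * B * c := by gcongr; omega
      omega) (idx B) (hrate B _ (by
    push_cast
    have h3 : η ≤ I / 8 := by nlinarith
    have h4 : 5 * I * (k * B) ≤ c * C * (k * B) := by gcongr
    have h5 : (k : ℝ) * I ≤ k * B * I := by nlinarith [mul_pos hk0 hI]
    have h6 : ((B : ℝ) + B - 1) * k * (I + η) ≤ (2 * B) * k * (9 / 8 * I) := by
      gcongr
      · linarith
      · linarith
    nlinarith))
  have hcode := (hchain B le_rfl).append hpS hkY hfinal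
  refine ⟨_, _, _, ?_, ?_, ?_, hcode⟩
  · have hc1 : 0 < c := by exact_mod_cast hc0
    positivity
  · have h3 : B * B * k ≤ ∑ j ∈ Finset.range B, (B + j) * k := by
      have := Finset.card_nsmul_le_sum (Finset.range B) (fun j => (B + j) * k) (B * k)
        (fun j _ => by gcongr; omega)
      simpa [mul_assoc] using this
    have h4 : (B : ℝ) * B * k ≤ (∑ j ∈ Finset.range B, (B + j) * k : ℕ) := by exact_mod_cast h3
    have h5 : (B : ℝ) * B * k * ε ≤ (∑ j ∈ Finset.range B, (B + j) * k : ℕ) * ε := by gcongr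
    have h6 : 2 * (c : ℝ) * (k * B) ≤ ε * B * (k * B) := by gcongr
    have h7 : 0 ≤ (k : ℝ) * B * c * (2 * ε) := by positivity
    rw [Nat.cast_add, Nat.cast_mul (k * B) c, Nat.cast_mul k B]
    nlinarith
  · have : (B : ℝ) * δ + δ = ε / 2 := by rw [hδ]; field_simp
    linarith

theorem sub_le_mul_log_div {p q : ℝ} (hp : 0 ≤ p) (hq : 0 ≤ q) (h : 0 < p → 0 < q) :
    p - q ≤ p * Real.log (p / q) := by
  rcases hp.eq_or_lt with rfl | hp
  · simpa using hq
  · have h1 := Real.one_sub_inv_le_log_of_pos (div_pos hp (h hp))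
    have h2 := mul_le_mul_of_nonneg_left h1 hp.le
    rwa [inv_div, mul_sub, mul_one, mul_div_cancel₀ _ hp.ne'] at h2

theorem eq_of_mul_log_div_le {p q : ℝ} (hp : 0 ≤ p) (hq : 0 ≤ q) (h : 0 < p → 0 < q)
    (hle : p * Real.log (p / q) ≤ p - q) : p = q := by
  rcases hp.eq_or_lt with rfl | hp
  · simp only [zero_mul, zero_sub, Left.nonneg_neg_iff] at hle
    exact hq.antisymm hle
  · by_contra hne
    have hq := h hp
    have h1 := Real.log_lt_sub_one_of_pos (div_pos hq hp) fun hcon =>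
      hne ((div_eq_one_iff_eq hp.ne').1 hcon).symm
    have h2 := mul_lt_mul_of_pos_left h1 hp
    rw [mul_sub, mul_one, mul_div_cancel₀ _ hp.ne', ← inv_div, Real.log_inv] at h2
    linarith

/-- Random variables with nonpositive mutual information are independent. -/
theorem margProb_mk_of_mutInfo_nonpos {Ω A B : Type*} [Fintype Ω] [Fintype A] [Fintype B]
    {P : Ω → ℝ} (hP : IsPMF P) (f : Ω → A) (g : Ω → B) (h : mutInfo P f g ≤ 0) (a : A) (b : B) :
    margProb P (fun ω => (f ω, g ω)) (a, b) = margProb P f a * margProb P g b := by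
  set p : A × B → ℝ := margProb P (fun ω => (f ω, g ω)) with hp
  set q : A × B → ℝ := fun c => margProb P f c.1 * margProb P g c.2 with hq
  have hp0 : ∀ c, 0 ≤ p c := margProb_nonneg hP _
  have hq0 : ∀ c, 0 ≤ q c := fun c => mul_nonneg (margProb_nonneg hP _ _) (margProb_nonneg hP _ _)
  have hpf : ∀ c, p c ≤ margProb P f c.1 := fun c => by
    rw [hp, margProb_eq_sum, margProb_eq_sum]
    exact Finset.sum_le_sum fun ω _ => mul_le_mul_of_nonneg_left
      (ind_mono fun h => by rw [← h]) (hP.1 ω)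
  have hpg : ∀ c, p c ≤ margProb P g c.2 := fun c => by
    rw [hp, margProb_eq_sum, margProb_eq_sum]
    exact Finset.sum_le_sum fun ω _ => mul_le_mul_of_nonneg_left
      (ind_mono fun h => by rw [← h]) (hP.1 ω)
  have hpq : ∀ c, 0 < p c → 0 < q c := fun c hc =>
    mul_pos (hc.trans_le (hpf c)) (hc.trans_le (hpg c))
  have hsum : ∑ c, (p c - q c) = 0 := by
    rw [Finset.sum_sub_distrib, (isPMF_margProb hP _).2, Fintype.sum_prod_type, hq]
    simp_rw [← Finset.mul_sum, (isPMF_margProb hP _).2, mul_one, (isPMF_margProb hP _).2, sub_self]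
  have hle : ∑ c, p c * Real.log (p c / q c) ≤ 0 := by
    have : mutInfo P f g = (∑ c, p c * Real.log (p c / q c)) / Real.log 2 := by
      unfold mutInfo
      rw [Fintype.sum_prod_type, Finset.sum_div]
      simp_rw [Finset.sum_div, mul_div_assoc]
      rfl
    rw [this] at h
    by_contra! hcon
    exact absurd h (not_le.2 (div_pos hcon (Real.log_pos (by norm_num))))
  have hterm : ∀ c ∈ Finset.univ, p c - q c ≤ p c * Real.log (p c / q c) := fun c _ =>
    sub_le_mul_log_div (hp0 c) (hq0 c) (hpq c)
  have heq := (Finset.sum_eq_sum_iff_of_le hterm).1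
    (le_antisymm (Finset.sum_le_sum hterm) (hle.trans hsum.ge)) (a, b) (Finset.mem_univ _)
  exact eq_of_mul_log_div_le (hp0 (a, b)) (hq0 (a, b)) (hpq (a, b)) heq.ge

theorem countDev_le {A : Type*} [Fintype A] {P : A → ℝ} (hP : IsPMF P) {n : ℕ} (w : Fin n → A) :
    countDev P w ≤ 2 * n := by
  have h1 : ∑ a, ∑ i, ind (w i = a) = (n : ℝ) := by
    rw [Finset.sum_comm]
    have : ∀ i, ∑ a, ind (w i = a) = 1 := fun i => by
      have := sum_mul_ind_eq (fun _ => (1 : ℝ)) (w i)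
      simpa [eq_comm] using this
    simp [this]
  calc countDev P w ≤ ∑ a, (∑ i, ind (w i = a) + n * P a) := Finset.sum_le_sum fun a _ => by
        refine (abs_sub _ _).trans (le_of_eq ?_)
        rw [abs_of_nonneg (Finset.sum_nonneg fun i _ => ind_nonneg _),
          abs_of_nonneg (mul_nonneg (Nat.cast_nonneg n) (hP.1 a))]
    _ = 2 * n := by rw [Finset.sum_add_distrib, h1, ← Finset.mul_sum, hP.2]; ring

theorem coveringDefect_unit {U S : Type*} [Fintype U] [Fintype S] {pU : U → ℝ} {pS : S → ℝ}
    (hpS : IsPMF pS) (n : ℕ) :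
    coveringDefect pU pS (fun _ _ (_ : Unit) => 1) n 1 = 0 := by
  refine Finset.sum_eq_zero fun u _ => mul_eq_zero_of_right _ ?_
  have hpn : IsPMF fun s : Fin n → S => ∏ i, pS (s i) := IsPMF.pi fun _ => hpS
  simpa using soft_covering_of_const (r := fun _ : Fin n → Unit => 1) hpn

section OutputInformation

variable {U S V X Y Z : Type*} [Fintype U] [Fintype S] [Fintype V] [Fintype X] [Fintype Y]
  [Fintype Z] {pU : U → ℝ} {pS : S → ℝ} {kV : S → U → V → ℝ} {kX : S → U → X → ℝ}
  {kY : X → Y → ℝ} {kZ : U → V → Y → Z → ℝ}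

theorem margProb_jointLaw_uvy (hkZ : ∀ u v y, IsPMF (kZ u v y)) (u : U) (v : V) (y : Y) :
    margProb (jointLaw pU pS kV kX kY kZ) (fun ω => ((ω.1, ω.2.2.1), ω.2.2.2.2.1)) ((u, v), y)
      = pU u * ∑ s, pS s * (kV s u v * ∑ x, kX s u x * kY x y) := by
  rw [margProb_eq_sum, sum_jointLaw_mul (fun u' _ v' _ y' _ => ind (((u', v'), y') = ((u, v), y)))]
  have h : ∀ u' v' x, ∑ y', kY x y' * ∑ z, kZ u' v' y' z * ind (((u', v'), y') = ((u, v), y))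
      = kY x y * ind (v' = v) * ind (u' = u) := fun u' v' x => by
    simp_rw [← Finset.sum_mul, (hkZ _ _ _).2, one_mul, ind_mk_eq]
    rw [← sum_mul_ind_eq (kY x) y, Finset.sum_mul, Finset.sum_mul]
    exact Finset.sum_congr rfl fun y' _ => by ring
  have h' : ∀ (c : ℝ) u' s', ∑ v', kV s' u' v' * (c * ind (v' = v) * ind (u' = u))
      = kV s' u' v * c * ind (u' = u) := fun c u' s' => by
    rw [← sum_mul_ind_eq (kV s' u') v, Finset.sum_mul, Finset.sum_mul]
    exact Finset.sum_congr rfl fun v' _ => by ring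
  simp_rw [h, ← mul_assoc, ← Finset.sum_mul, h', ← mul_assoc, ← Finset.sum_mul, ← mul_assoc,
    sum_mul_ind_eq]

theorem mutInfo_output_eq_zero (hpU : IsPMF pU) (hpS : IsPMF pS) (hkV : ∀ s u, IsPMF (kV s u))
    (hkX : ∀ s u, IsPMF (kX s u)) (hkY : ∀ x, IsPMF (kY x)) (hkZ : ∀ u v y, IsPMF (kZ u v y))
    {r : Y → ℝ} (hr : ∀ x, kY x = r) :
    mutInfo (jointLaw pU pS kV kX kY kZ) (fun ω => (ω.1, ω.2.2.1)) (fun ω => ω.2.2.2.2.1) = 0 := by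
  unfold mutInfo
  refine Finset.sum_eq_zero fun ⟨u, v⟩ _ => Finset.sum_eq_zero fun y _ => ?_
  rw [margProb_jointLaw_uvy hkZ, margProb_jointLaw_uv hkX hkY hkZ, margProb_jointLaw_y hkZ]
  have hx : ∀ s u, ∑ x, kX s u x * kY x y = r y := fun s u => by
    simp_rw [hr, ← Finset.sum_mul, (hkX _ _).2, one_mul]
  have hy : ∑ u, pU u * ∑ s, pS s * ∑ v, kV s u v * r y = r y := by
    simp_rw [← Finset.sum_mul, (hkV _ _).2, one_mul, ← Finset.sum_mul, hpS.2, hpU.2, one_mul]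
  simp_rw [hx, hy, ← mul_assoc, ← Finset.sum_mul, mixW, ← mul_assoc]
  by_cases h : pU u * (∑ s, pS s * kV s u v) * r y = 0
  · rw [h, zero_mul]
  · rw [div_self h, Real.logb_one, mul_zero]

/-- Uniform inputs, chosen without regard to the source, convey information through a channel
with distinct rows. -/
theorem mutInfo_uniform_input_pos [Nonempty X] (hpS : IsPMF pS) (hkY : ∀ x, IsPMF (kY x))
    {kZ : X → Unit → Y → Z → ℝ} (hkZ : ∀ u v y, IsPMF (kZ u v y)) (hne : ∀ r, ¬∀ x, kY x = r) :
    0 < mutInfo (jointLaw (fun _ : X => (Fintype.card X : ℝ)⁻¹) pS (fun _ _ _ => 1)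
      (fun _ u x => ind (x = u)) kY kZ) (fun ω => (ω.1, ω.2.2.1)) (fun ω => ω.2.2.2.2.1) := by
  have hc : (Fintype.card X : ℝ) ≠ 0 := Nat.cast_ne_zero.2 Fintype.card_ne_zero
  have hpU : IsPMF (fun _ : X => (Fintype.card X : ℝ)⁻¹) :=
    ⟨fun _ => by positivity, by simp [hc]⟩
  have hkV : ∀ (s : S) (u : X), IsPMF (fun _ : Unit => (1 : ℝ)) := fun _ _ =>
    ⟨fun _ => zero_le_one, by simp⟩
  have hkX : ∀ (s : S) (u : X), IsPMF (fun x => ind (x = u)) := fun s u =>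
    ⟨fun _ => ind_nonneg _, by simpa using sum_mul_ind_eq (fun _ => (1 : ℝ)) u⟩
  by_contra! hcon
  have h := margProb_mk_of_mutInfo_nonpos (isPMF_jointLaw hpU hpS hkV hkX hkY hkZ) _ _ hcon
  refine hne (margProb (jointLaw (fun _ : X => (Fintype.card X : ℝ)⁻¹) pS (fun _ _ _ => 1)
    (fun _ u x => ind (x = u)) kY kZ) fun ω => ω.2.2.2.2.1) fun x => funext fun y => ?_
  have hxy := h (x, ()) y
  rw [margProb_jointLaw_uvy hkZ, margProb_jointLaw_uv hkX hkY hkZ] at hxy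
  simp_rw [mul_comm (ind _) (kY _ _), sum_mul_ind_eq, one_mul, mixW, mul_one, ← Finset.sum_mul,
    hpS.2, one_mul, mul_one] at hxy
  exact mul_left_cancel₀ (inv_ne_zero hc) hxy

end OutputInformation

theorem mul_two_rpow_neg_add_le {n : ℕ} {m R θ c δ : ℝ} (hδ : 0 ≤ δ)
    (h : m * (2 : ℝ) ^ (-(n * R)) ≤ δ) (hθ : (2 : ℝ) ^ (-(n * θ)) ≤ c) :
    m * (2 : ℝ) ^ (-(n * (R + θ))) ≤ δ * c := by
  rw [mul_add, neg_add, Real.rpow_add (by norm_num), ← mul_assoc]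
  exact mul_le_mul h hθ (by positivity) hδ

section Assembly

variable {U S V X Y Z : Type*} [Fintype U] [Fintype S] [Fintype V] [Fintype X] [Fintype Y]
  [Fintype Z] {pU : U → ℝ} {pS : S → ℝ} {kV : S → U → V → ℝ} {kX : S → U → X → ℝ}
  {kY : X → Y → ℝ} {kZ : U → V → Y → Z → ℝ}

theorem isPMF_unit : IsPMF fun _ : Unit => (1 : ℝ) := ⟨fun _ => zero_le_one, by simp⟩

theorem isPMF_ind_eq {A : Type*} [Fintype A] (a : A) : IsPMF fun x => ind (x = a) :=
  ⟨fun _ => ind_nonneg _, by simpa using sum_mul_ind_eq (fun _ => (1 : ℝ)) a⟩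

/-- With a useful channel, the index left open by the last block is conveyed by uncoded
transmission. -/
theorem achievable_of_mutInfo_pos (hpU : IsPMF pU) (hpS : IsPMF pS)
    (hkV : ∀ s u, IsPMF (kV s u)) (hkX : ∀ s u, IsPMF (kX s u)) (hkY : ∀ x, IsPMF (kY x))
    (hkZ : ∀ u v y, IsPMF (kZ u v y))
    (hI : mutInfo (jointLaw pU pS kV kX kY kZ) (fun ω => (ω.1, ω.2.2.1)) (fun ω => ω.2.1)
      ≤ mutInfo (jointLaw pU pS kV kX kY kZ) (fun ω => (ω.1, ω.2.2.1)) (fun ω => ω.2.2.2.2.1))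
    (hpos : 0 < mutInfo (jointLaw pU pS kV kX kY kZ) (fun ω => (ω.1, ω.2.2.1))
      (fun ω => ω.2.2.2.2.1)) :
    Achievable pS kY EncoderClass.causal (margProb (jointLaw pU pS kV kX kY kZ)
      fun ω => (ω.2.1, ω.2.2.2.1, ω.2.2.2.2.1, ω.2.2.2.2.2)) := by
  have hJ := isPMF_jointLaw hpU hpS hkV hkX hkY hkZ
  obtain ⟨ω₀⟩ := hJ.nonempty
  have : Nonempty X := ⟨ω₀.2.2.2.1⟩
  have hne : ∀ r, ¬∀ x, kY x = r := fun r hr =>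
    hpos.ne' (mutInfo_output_eq_zero hpU hpS hkV hkX hkY hkZ hr)
  set zK : X → Unit → Y → Z → ℝ := fun _ _ _ z => ind (z = ω₀.2.2.2.2.2)
  have hzK : ∀ u v y, IsPMF (zK u v y) := fun _ _ _ => isPMF_ind_eq _
  have hC := mutInfo_uniform_input_pos (pS := pS) (kZ := zK) hpS hkY hzK hne
  set C := mutInfo (jointLaw (fun _ : X => (Fintype.card X : ℝ)⁻¹) pS (fun _ _ _ => 1)
      (fun _ u x => ind (x = u)) kY zK) (fun ω => (ω.1, ω.2.2.1)) (fun ω => ω.2.2.2.2.1) with hCdef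
  have hpX : IsPMF (fun _ : X => (Fintype.card X : ℝ)⁻¹) :=
    ⟨fun _ => by positivity, by simp⟩
  have hsplit : ∀ δ : ℝ, 4 * (δ * (1 / 4)) = δ := fun δ => by ring
  refine achievable_of_block_codes hpS hkY hpos (half_pos hC) (fun η ε δ hη hε hδ => ?_)
    fun δ hδ => ?_
  · have hδ' : 0 < δ * (1 / 4) := by positivity
    obtain ⟨n₁, h₁⟩ := eventually_hasBlockCode hpU hpS hkV hkX hkY hkZ (half_pos hη) hδ'
    obtain ⟨n₂, h₂⟩ := eventually_coveringDefect_le hpU hpS hkV hkX hkY hkZ hη hδ'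
    obtain ⟨n₃, h₃⟩ := eventually_prob_countDev_le hJ
      (fun ω => (ω.2.1, ω.2.2.2.1, ω.2.2.2.2.1, ω.2.2.2.2.2)) hε hδ'
    obtain ⟨n₄, h₄⟩ := eventually_two_rpow_neg_le (half_pos hη) (δ := 1 / 4) (by norm_num)
    refine ⟨n₁ + n₂ + n₃ + n₄, fun n hn M K hM hK => ?_⟩
    rw [← hsplit δ]
    refine h₁ n (by omega) M K _ _ ?_ ?_ (h₂ n (by omega) K (le_trans ?_ hK)) (h₃ n (by omega))
    · exact Nat.cast_pos.1 ((Real.rpow_pos_of_pos two_pos _).trans_le hK)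
    · have := mul_two_rpow_neg_add_le hδ.le hM (h₄ n (by omega))
      rwa [sub_add, sub_half] at this
    · exact Real.rpow_le_rpow_of_exponent_le (by norm_num) (by gcongr)
  · have hδ' : 0 < δ * (1 / 4) := by positivity
    obtain ⟨n₁, h₁⟩ := eventually_hasBlockCode hpX hpS (fun _ _ => isPMF_unit)
      (fun _ u => isPMF_ind_eq u) hkY hzK (half_pos (half_pos hC)) hδ'
    obtain ⟨n₂, h₂⟩ := eventually_two_rpow_neg_le (half_pos (half_pos hC)) (δ := 1 / 4)
      (by norm_num)
    refine ⟨n₁ + n₂, fun n hn M hM => ?_⟩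
    rw [← hsplit δ]
    refine h₁ n (by omega) M 1 _ _ one_pos ?_ ?_ ?_
    · have := mul_two_rpow_neg_add_le hδ.le hM (h₂ n (by omega))
      convert this using 5
      ring
    · rw [coveringDefect_unit hpS]
      exact hδ'.le
    · refine le_of_eq_of_le (Finset.sum_eq_zero fun w _ => mul_eq_zero_of_right _
        (ind_of_false (not_lt.2 (countDev_le (isPMF_margProb hJ _) _)))) hδ'.le

/-- With a useless channel the auxiliary variables are independent of the source and can be drawn
in advance as common randomness. -/
theorem achievable_of_mutInfo_nonpos (hpU : IsPMF pU) (hpS : IsPMF pS)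
    (hkV : ∀ s u, IsPMF (kV s u)) (hkX : ∀ s u, IsPMF (kX s u)) (hkY : ∀ x, IsPMF (kY x))
    (hkZ : ∀ u v y, IsPMF (kZ u v y))
    (hI : mutInfo (jointLaw pU pS kV kX kY kZ) (fun ω => (ω.1, ω.2.2.1)) (fun ω => ω.2.1) ≤ 0) :
    Achievable pS kY EncoderClass.causal (margProb (jointLaw pU pS kV kX kY kZ)
      fun ω => (ω.2.1, ω.2.2.2.1, ω.2.2.2.2.1, ω.2.2.2.2.2)) := by
  have hJ := isPMF_jointLaw hpU hpS hkV hkX hkY hkZ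
  have hind : ∀ u s v, pU u * (pS s * kV s u v) = pU u * mixW pS (fun s => kV s u) v * pS s := by
    intro u s v
    rw [← margProb_jointLaw_uvs (pU := pU) hkX hkY hkZ, ← margProb_jointLaw_uv hkX hkY hkZ,
      margProb_mk_of_mutInfo_nonpos hJ _ _ hI, margProb_jointLaw_s hpU hkV hkX hkY hkZ]
  set pW : U × V → ℝ := fun w => pU w.1 * mixW pS (fun s => kV s w.1) w.2 with hpWdef
  have hpW : IsPMF pW := by
    refine ⟨fun w => mul_nonneg (hpU.1 _) ((isPMF_mixW hpS fun s => hkV s _).1 _), ?_⟩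
    rw [hpWdef, Fintype.sum_prod_type]
    simp_rw [← Finset.mul_sum, (isPMF_mixW hpS fun s => hkV s _).2, mul_one, hpU.2]
  set J' := jointLaw pW pS (fun _ _ (_ : Unit) => 1) (fun s w => kX s w.1) kY
    (fun w _ y => kZ w.1 w.2 y) with hJ'def
  have hkX' : ∀ (s : S) (w : U × V), IsPMF (kX s w.1) := fun s w => hkX s w.1
  have hkZ' : ∀ (w : U × V) (_ : Unit) (y : Y), IsPMF (kZ w.1 w.2 y) := fun w _ y => hkZ _ _ _
  have hJ' : IsPMF J' := isPMF_jointLaw hpW hpS (fun _ _ => isPMF_unit) hkX' hkY hkZ'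
  have hP : margProb (jointLaw pU pS kV kX kY kZ)
      (fun ω => (ω.2.1, ω.2.2.2.1, ω.2.2.2.2.1, ω.2.2.2.2.2))
        = margProb J' fun ω => (ω.2.1, ω.2.2.2.1, ω.2.2.2.2.1, ω.2.2.2.2.2) := by
    funext c
    rw [margProb_eq_sum, margProb_eq_sum,
      sum_jointLaw_mul (fun _ s _ x y z => ind ((s, x, y, z) = c)),
      sum_jointLaw_mul (fun _ s _ x y z => ind ((s, x, y, z) = c)), Fintype.sum_prod_type]
    refine Finset.sum_congr rfl fun u _ => ?_
    simp_rw [Finset.univ_unique, Finset.sum_singleton, one_mul]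
    rw [Finset.mul_sum]
    simp_rw [Finset.mul_sum (Finset.univ : Finset S)]
    rw [Finset.sum_comm]
    refine Finset.sum_congr rfl fun s _ => ?_
    rw [← mul_assoc, Finset.mul_sum]
    refine Finset.sum_congr rfl fun v _ => ?_
    rw [← mul_assoc, ← mul_assoc, mul_assoc (pU u), hind]
  rw [hP]
  refine achievable_of_hasCode hpS hkY fun ε hε => ?_
  have hδ : 0 < ε / 8 := by positivity
  obtain ⟨n₁, h₁⟩ := eventually_hasBlockCode hpW hpS (fun _ _ => isPMF_unit) hkX' hkY hkZ'
    one_pos hδ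
  obtain ⟨n₂, h₂⟩ := eventually_prob_countDev_le hJ'
    (fun ω => (ω.2.1, ω.2.2.2.1, ω.2.2.2.2.1, ω.2.2.2.2.2)) hε hδ
  have hcode := (hasCode_zero pS kY (margProb J' fun ω =>
    (ω.2.1, ω.2.2.2.1, ω.2.2.2.2.1, ω.2.2.2.2.2))).append hpS hkY
    (h₁ (n₁ + n₂ + 1) (by omega) 1 1 _ _ one_pos (by simpa using hδ.le)
      ((coveringDefect_unit hpS _).trans_le hδ.le) (h₂ (n₁ + n₂ + 1) (by omega)))
  refine ⟨_, _, _, by omega, ?_, ?_, hcode⟩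
  · rw [zero_add, zero_add]
    gcongr
    linarith
  · linarith

end Assembly

theorem margProb_comp_equiv {Ω Ω' A : Type*} [Fintype Ω] [Fintype Ω'] (e : Ω' ≃ Ω) (P : Ω → ℝ)
    (f : Ω → A) : margProb (fun ω => P (e ω)) (fun ω => f (e ω)) = margProb P f := by
  funext a
  rw [margProb_eq_sum, margProb_eq_sum]
  exact Fintype.sum_equiv e _ _ fun _ => rfl

theorem mutInfo_comp_equiv {Ω Ω' A B : Type*} [Fintype Ω] [Fintype Ω'] [Fintype A] [Fintype B]
    (e : Ω' ≃ Ω) (P : Ω → ℝ) (f : Ω → A) (g : Ω → B) :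
    mutInfo (fun ω => P (e ω)) (fun ω => f (e ω)) (fun ω => g (e ω)) = mutInfo P f g := by
  unfold mutInfo
  rw [margProb_comp_equiv e, margProb_comp_equiv e, margProb_comp_equiv e P fun ω => (f ω, g ω)]

/-- Rearrangement of the joint variables, auxiliary ones last. -/
def jointEquiv (U S V X Y Z : Type*) : U × S × V × X × Y × Z ≃ S × X × Y × Z × U × V where
  toFun := fun (u, s, v, x, y, z) => (s, x, y, z, u, v)
  invFun := fun (s, x, y, z, u, v) => (u, s, v, x, y, z)
  left_inv _ := rfl
  right_inv _ := rfl

/-- **Theorem 2 (Causal encoder, achievability).**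
If there are finite sets `U`, `V` and a joint pmf `Q` on `S × X × Y × Ŝ × U × V`
factoring as `P_S · P_U · P_{V|SU} · P_{X|SU} · P_{Y|X} · P_{Ŝ|UVY}` with
`I(U,V;S) ≤ I(U,V;Y)`, then the `(S,X,Y,Ŝ)`-marginal `P` of `Q` is achievable
with a causal encoder. -/
theorem causal_achievability
    {S X Y Z U V : Type}
    [Fintype S] [Fintype X] [Fintype Y] [Fintype Z] [Fintype U] [Fintype V]
    (PS : S → ℝ) (PYX : X → Y → ℝ)
    (hPS : IsPMF PS) (hPYX : ∀ x, IsPMF (PYX x))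
    (PU : U → ℝ) (PVgSU : S → U → V → ℝ) (PXgSU : S → U → X → ℝ)
    (PZgUVY : U → V → Y → Z → ℝ)
    (hPU : IsPMF PU) (hPVgSU : ∀ s u, IsPMF (PVgSU s u))
    (hPXgSU : ∀ s u, IsPMF (PXgSU s u)) (hPZgUVY : ∀ u v y, IsPMF (PZgUVY u v y))
    (Q : S × X × Y × Z × U × V → ℝ)
    (hQ : ∀ s x y z u v,
      Q (s, x, y, z, u, v)
        = PS s * PU u * PVgSU s u v * PXgSU s u x * PYX x y * PZgUVY u v y z)
    (hMI : mutInfo Q (fun ω => (ω.2.2.2.2.1, ω.2.2.2.2.2)) (fun ω => ω.1)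
         ≤ mutInfo Q (fun ω => (ω.2.2.2.2.1, ω.2.2.2.2.2)) (fun ω => ω.2.2.1))
    (P : S × X × Y × Z → ℝ)
    (hP : ∀ s x y z, P (s, x, y, z) = ∑ u, ∑ v, Q (s, x, y, z, u, v)) :
    Achievable PS PYX EncoderClass.causal P := by
  set J := jointLaw PU PS PVgSU PXgSU PYX PZgUVY with hJ
  have hQJ : (fun ω => Q (jointEquiv U S V X Y Z ω)) = J := by
    funext ⟨u, s, v, x, y, z⟩
    simp only [jointEquiv, Equiv.coe_fn_mk, hQ, hJ, jointLaw]
    ring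
  rw [← mutInfo_comp_equiv (jointEquiv U S V X Y Z), ← mutInfo_comp_equiv (jointEquiv U S V X Y Z),
    hQJ] at hMI
  have hPJ : P = margProb J fun ω => (ω.2.1, ω.2.2.2.1, ω.2.2.2.2.1, ω.2.2.2.2.2) := by
    funext ⟨s, x, y, z⟩
    have := margProb_comp_equiv (jointEquiv U S V X Y Z) Q fun ω => (ω.1, ω.2.1, ω.2.2.1, ω.2.2.2.1)
    rw [hQJ] at this
    refine Eq.trans ?_ (congrFun this (s, x, y, z)).symm
    rw [← sum_mul_ind_eq P (s, x, y, z), margProb_eq_sum]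
    simp_rw [Fintype.sum_prod_type, hP, Finset.sum_mul]
  rw [hPJ]
  by_cases hpos : 0 < mutInfo J (fun ω => (ω.1, ω.2.2.1)) (fun ω => ω.2.2.2.2.1)
  · exact achievable_of_mutInfo_pos hPU hPS hPVgSU hPXgSU hPYX hPZgUVY hMI hpos
  · exact achievable_of_mutInfo_nonpos hPU hPS hPVgSU hPXgSU hPYX hPZgUVY
      (hMI.trans (not_lt.1 hpos))

end
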